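/- Let P be a simplicial d-polytope with d ≥ 4, and let f_0 and f_1 denote its numbers of vertices and edges. Then h_1(P) ≤ h_2(P); equivalently, f_1 ≥ d·f_0 − C(d+1, 2). -/

import Mathlib

open Set

/-- A polytope: the convex hull of a finite set of points. -/
def IsPolytope {E : Type*} [AddCommGroup E] [Module ℝ E] (P : Set E) : Prop :=
  ∃ V : Finset E, P = convexHull ℝ (V : Set E)

/-- A (nonempty, proper) exposed face of `P`. -/
def IsProperFace {E : Type*} [AddCommGroup E] [Module ℝ E] [TopologicalSpace E]
    (P F : Set E) : Prop :=
  F.Nonempty ∧ F ≠ P ∧ IsExposed ℝ P F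

/-- A polytope is simplicial if the vertices (extreme points) of each proper face are
affinely independent. -/
def IsSimplicial {d : ℕ} (P : Set (Fin d → ℝ)) : Prop :=
  ∀ F : Set (Fin d → ℝ), IsProperFace P F →
    AffineIndependent ℝ (fun x : F.extremePoints ℝ => (x : Fin d → ℝ))

/-- The number of `j`-dimensional proper faces of `P`. -/
noncomputable def faceCount {d : ℕ} (P : Set (Fin d → ℝ)) (j : ℕ) : ℕ :=
  Set.ncard {F : Set (Fin d → ℝ) |
    IsProperFace P F ∧ Module.finrank ℝ (affineSpan ℝ F).direction = j}

/-- `f_{j-1}(P)` with the convention `f_{-1} = 1`. -/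
noncomputable def fm {d : ℕ} (P : Set (Fin d → ℝ)) (j : ℕ) : ℤ :=
  if j = 0 then 1 else (faceCount P (j - 1) : ℤ)

/-- The `h`-numbers of a simplicial `d`-polytope:
`h_i = ∑_{j=0}^{i} (-1)^{i-j} C(d-j, i-j) f_{j-1}`. -/
noncomputable def hP {d : ℕ} (P : Set (Fin d → ℝ)) (i : ℕ) : ℤ :=
  ∑ j ∈ Finset.range (i + 1),
    (-1 : ℤ) ^ (i - j) * ((d - j).choose (i - j)) * fm P j

section LowerBound

open Module Finset

open scoped Classical in
/-- Facets of a simplicial fan over the boundary of a polytope, given by finite sets of vectors,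
together with supporting functionals `supp`, a central vector and coordinates with respect to each
facet completed by the central vector. -/
structure FacetSystem (V : Type*) [AddCommGroup V] [Module ℝ V] (d : ℕ) where
  facets : Finset (Finset V)
  center : V
  supp : Finset V → Dual ℝ V
  coord : Finset V → V → Dual ℝ V
  card_eq : ∀ t ∈ facets, t.card = d
  supp_self : ∀ t ∈ facets, ∀ i ∈ t, supp t i = 0
  supp_pos : ∀ t ∈ facets, ∀ s ∈ facets, ∀ i ∈ s, i ∉ t → 0 < supp t i
  supp_center : ∀ t ∈ facets, supp t center = 1
  coord_self : ∀ t ∈ facets, ∀ i ∈ t, coord t i i = 1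
  coord_ne : ∀ t ∈ facets, ∀ i ∈ t, ∀ j ∈ t, j ≠ i → coord t i j = 0
  coord_center : ∀ t ∈ facets, ∀ i ∈ t, coord t i center = 0
  expand : ∀ t ∈ facets, ∀ v, v = ∑ i ∈ t, coord t i v • i + supp t v • center
  pivot : ∀ t ∈ facets, ∀ k ∈ t, ∃ l ∉ t, insert l (t.erase k) ∈ facets

open scoped Classical in
theorem notMem_insert_erase {α : Type*} {t : Finset α} {k l : α} (hk : k ∈ t) (hl : l ∉ t) :
    k ∉ insert l (t.erase k) := by
  have : k ≠ l := fun h => hl (h ▸ hk)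
  simp [this]

namespace FacetSystem

open scoped Classical

variable {V : Type*} [AddCommGroup V] [Module ℝ V] {d : ℕ} (F : FacetSystem V d)

theorem apply_eq {t : Finset V} (ht : t ∈ F.facets) (f : Dual ℝ V) (v : V) :
    f v = ∑ i ∈ t, F.coord t i v * f i + F.supp t v * f F.center := by
  conv_lhs => rw [F.expand t ht v]
  simp

theorem apply_eq_of_erase {t : Finset V} (ht : t ∈ F.facets) {k : V} (hk : k ∈ t)
    {f : Dual ℝ V} (hf : ∀ i ∈ t.erase k, f i = 0) (v : V) :
    f v = F.coord t k v * f k + F.supp t v * f F.center := by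
  rw [F.apply_eq ht f v, ← Finset.add_sum_erase _ _ hk,
    Finset.sum_eq_zero (s := t.erase k) fun i hi => by rw [hf i hi, mul_zero], add_zero]

theorem supp_nonneg {t s : Finset V} (ht : t ∈ F.facets) (hs : s ∈ F.facets) {i : V}
    (hi : i ∈ s) : 0 ≤ F.supp t i := by
  by_cases h : i ∈ t
  · exact (F.supp_self t ht i h).ge
  · exact (F.supp_pos t ht s hs i hi h).le

theorem subset_of_supp_eq_zero {t s : Finset V} (ht : t ∈ F.facets) (hs : s ∈ F.facets)
    (h : ∀ i ∈ s, F.supp t i = 0) : s = t :=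
  Finset.eq_of_subset_of_card_le
    (fun i hi => by
      by_contra hit
      exact (F.supp_pos t ht s hs i hi hit).ne' (h i hi))
    (by rw [F.card_eq t ht, F.card_eq s hs])

theorem supp_adj {t : Finset V} (ht : t ∈ F.facets) {k l : V} (hk : k ∈ t)
    (hs : insert l (t.erase k) ∈ F.facets) (v : V) :
    F.supp (insert l (t.erase k)) v
      = F.coord t k v * F.supp (insert l (t.erase k)) k + F.supp t v := by
  rw [F.apply_eq_of_erase ht hk
    (fun i hi => F.supp_self _ hs i (Finset.mem_insert_of_mem hi)) v, F.supp_center _ hs, mul_one]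

theorem supp_adj_pos {t : Finset V} (ht : t ∈ F.facets) {k l : V} (hk : k ∈ t) (hl : l ∉ t)
    (hs : insert l (t.erase k) ∈ F.facets) : 0 < F.supp (insert l (t.erase k)) k :=
  F.supp_pos _ hs t ht k hk (notMem_insert_erase hk hl)

theorem supp_new_pos {t : Finset V} (ht : t ∈ F.facets) {k l : V} (hl : l ∉ t)
    (hs : insert l (t.erase k) ∈ F.facets) : 0 < F.supp t l :=
  F.supp_pos t ht _ hs l (Finset.mem_insert_self _ _) hl

theorem supp_new_eq {t : Finset V} (ht : t ∈ F.facets) {k l : V} (hk : k ∈ t)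
    (hs : insert l (t.erase k) ∈ F.facets) :
    F.supp t l = -(F.coord t k l * F.supp (insert l (t.erase k)) k) := by
  have := F.supp_adj ht hk hs l
  rw [F.supp_self _ hs l (Finset.mem_insert_self _ _)] at this
  linarith

theorem coord_new_neg {t : Finset V} (ht : t ∈ F.facets) {k l : V} (hk : k ∈ t) (hl : l ∉ t)
    (hs : insert l (t.erase k) ∈ F.facets) : F.coord t k l < 0 := by
  have h1 := F.supp_new_eq ht hk hs
  have h2 := F.supp_new_pos ht hl hs
  have h3 := F.supp_adj_pos ht hk hl hs
  by_contra h
  push Not at h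
  nlinarith [mul_nonneg h h3.le]

theorem coord_adj {t : Finset V} (ht : t ∈ F.facets) {k l : V} (hk : k ∈ t) (hl : l ∉ t)
    (hs : insert l (t.erase k) ∈ F.facets) (v : V) :
    F.coord t k v = F.coord t k l * F.coord (insert l (t.erase k)) l v := by
  have hl' : l ∉ t.erase k := fun h => hl (Finset.mem_of_mem_erase h)
  rw [F.apply_eq_of_erase hs (Finset.mem_insert_self _ _) (f := F.coord t k) ?_ v,
    F.coord_center t ht k hk, mul_zero, add_zero, mul_comm]
  intro i hi
  rw [Finset.erase_insert hl'] at hi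
  exact F.coord_ne t ht k hk i (Finset.mem_of_mem_erase hi) (Finset.ne_of_mem_erase hi)

theorem adj_unique {t : Finset V} (ht : t ∈ F.facets) {k l m : V} (hk : k ∈ t) (hl : l ∉ t)
    (hs : insert l (t.erase k) ∈ F.facets) (hm : m ∉ t)
    (hr : insert m (t.erase k) ∈ F.facets) : m = l := by
  by_contra hml
  have hl' : l ∉ t.erase k := fun h => hl (Finset.mem_of_mem_erase h)
  have hms : m ∉ insert l (t.erase k) := by simp [hml, hm]
  have h1 := F.coord_new_neg ht hk hl hs
  have h2 := F.coord_new_neg ht hk hm hr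
  have h3 : F.coord (insert l (t.erase k)) l m < 0 :=
    F.coord_new_neg hs (Finset.mem_insert_self _ _) hms (by rwa [Finset.erase_insert hl'])
  have h4 := F.coord_adj ht hk hl hs m
  nlinarith [mul_pos_of_neg_of_neg h1 h3]

/-- The vertex replacing `k` when crossing the ridge opposite to `k` in the facet `t`. -/
noncomputable def opp (t : Finset V) (k : V) : V :=
  if h : t ∈ F.facets ∧ k ∈ t then (F.pivot t h.1 k h.2).choose else 0

/-- The facet on the other side of the ridge opposite to `k` in the facet `t`. -/
noncomputable def nb (t : Finset V) (k : V) : Finset V := insert (F.opp t k) (t.erase k)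

theorem opp_notMem {t : Finset V} (ht : t ∈ F.facets) {k : V} (hk : k ∈ t) : F.opp t k ∉ t := by
  rw [opp, dif_pos ⟨ht, hk⟩]
  exact (F.pivot t ht k hk).choose_spec.1

theorem nb_mem {t : Finset V} (ht : t ∈ F.facets) {k : V} (hk : k ∈ t) : F.nb t k ∈ F.facets := by
  rw [nb, opp, dif_pos ⟨ht, hk⟩]
  exact (F.pivot t ht k hk).choose_spec.2

theorem opp_mem_nb (t : Finset V) (k : V) : F.opp t k ∈ F.nb t k := Finset.mem_insert_self _ _

theorem nb_erase {t : Finset V} (ht : t ∈ F.facets) {k : V} (hk : k ∈ t) :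
    (F.nb t k).erase (F.opp t k) = t.erase k :=
  Finset.erase_insert fun h => F.opp_notMem ht hk (Finset.mem_of_mem_erase h)

theorem notMem_nb {t : Finset V} (ht : t ∈ F.facets) {k : V} (hk : k ∈ t) : k ∉ F.nb t k :=
  notMem_insert_erase hk (F.opp_notMem ht hk)

theorem opp_opp {t : Finset V} (ht : t ∈ F.facets) {k : V} (hk : k ∈ t) :
    F.opp (F.nb t k) (F.opp t k) = k := by
  have hs := F.nb_mem ht hk
  refine (F.adj_unique hs (F.opp_mem_nb t k) (F.opp_notMem hs (F.opp_mem_nb t k))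
    (F.nb_mem hs (F.opp_mem_nb t k)) (F.notMem_nb ht hk) ?_).symm
  rwa [F.nb_erase ht hk, Finset.insert_erase hk]

theorem nb_nb {t : Finset V} (ht : t ∈ F.facets) {k : V} (hk : k ∈ t) :
    F.nb (F.nb t k) (F.opp t k) = t := by
  rw [nb, F.opp_opp ht hk, F.nb_erase ht hk, Finset.insert_erase hk]

/-- The facets containing a face `τ`. -/
noncomputable def star (τ : Finset V) : Finset (Finset V) := F.facets.filter (τ ⊆ ·)

theorem mem_star {τ t : Finset V} : t ∈ F.star τ ↔ t ∈ F.facets ∧ τ ⊆ t := Finset.mem_filter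

theorem nb_mem_star {τ t : Finset V} (ht : t ∈ F.star τ) {k : V} (hk : k ∈ t \ τ) :
    F.nb t k ∈ F.star τ := by
  rw [mem_star] at ht ⊢
  rw [Finset.mem_sdiff] at hk
  refine ⟨F.nb_mem ht.1 hk.1, fun i hi => Finset.mem_insert_of_mem ?_⟩
  exact Finset.mem_erase.2 ⟨fun h => hk.2 (h ▸ hi), ht.2 hi⟩

theorem opp_mem_sdiff {τ t : Finset V} (ht : t ∈ F.star τ) {k : V} (hk : k ∈ t \ τ) :
    F.opp t k ∈ F.nb t k \ τ := by
  rw [mem_star] at ht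
  rw [Finset.mem_sdiff] at hk ⊢
  exact ⟨F.opp_mem_nb t k, fun h => F.opp_notMem ht.1 hk.1 (ht.2 h)⟩

theorem sum_flags_nb (τ : Finset V) (H : Finset V → V → ℝ) :
    ∑ t ∈ F.star τ, ∑ k ∈ t \ τ, H (F.nb t k) (F.opp t k)
      = ∑ t ∈ F.star τ, ∑ k ∈ t \ τ, H t k := by
  rw [Finset.sum_sigma', Finset.sum_sigma']
  have hmem : ∀ x ∈ (F.star τ).sigma (fun t => t \ τ),
      (⟨F.nb x.1 x.2, F.opp x.1 x.2⟩ : Σ _ : Finset V, V) ∈ (F.star τ).sigma (fun t => t \ τ) := by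
    intro x hx
    rw [Finset.mem_sigma] at hx ⊢
    exact ⟨F.nb_mem_star hx.1 hx.2, F.opp_mem_sdiff hx.1 hx.2⟩
  have hinv : ∀ x ∈ (F.star τ).sigma (fun t => t \ τ),
      (⟨F.nb (F.nb x.1 x.2) (F.opp x.1 x.2), F.opp (F.nb x.1 x.2) (F.opp x.1 x.2)⟩ :
        Σ _ : Finset V, V) = x := by
    intro x hx
    rw [Finset.mem_sigma] at hx
    have h1 := (F.mem_star.1 hx.1).1
    have h2 := (Finset.mem_sdiff.1 hx.2).1
    rw [F.nb_nb h1 h2, F.opp_opp h1 h2]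
  exact Finset.sum_bij' (fun x _ => ⟨F.nb x.1 x.2, F.opp x.1 x.2⟩)
    (fun x _ => ⟨F.nb x.1 x.2, F.opp x.1 x.2⟩) hmem hmem hinv hinv (fun x _ => rfl)

/-- Facets are connected through ridges (pivoting as in the simplex algorithm). -/
theorem facets_connected {C : Finset V → Prop} {t₀ : Finset V} (ht₀ : t₀ ∈ F.facets) (h₀ : C t₀)
    (hC : ∀ t ∈ F.facets, C t → ∀ k ∈ t, C (F.nb t k)) :
    ∀ t ∈ F.facets, C t := by
  intro r hr
  obtain ⟨t, ht, hmin⟩ := Finset.exists_min_image (F.facets.filter C)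
    (fun t => F.supp t (∑ i ∈ r, i)) ⟨t₀, Finset.mem_filter.2 ⟨ht₀, h₀⟩⟩
  rw [Finset.mem_filter] at ht
  obtain ⟨ht, hCt⟩ := ht
  have hpos : ∀ k ∈ t, 0 ≤ F.coord t k (∑ i ∈ r, i) := by
    intro k hk
    by_contra hneg
    push Not at hneg
    have h1 := hmin (F.nb t k) (Finset.mem_filter.2 ⟨F.nb_mem ht hk, hC t ht hCt k hk⟩)
    have h2 := F.supp_adj ht hk (F.nb_mem ht hk) (∑ i ∈ r, i)
    have h3 := F.supp_adj_pos ht hk (F.opp_notMem ht hk) (F.nb_mem ht hk)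
    rw [← nb] at h2 h3
    nlinarith
  have hrt : ∀ i ∈ r, 0 ≤ F.supp t i := fun i hi => F.supp_nonneg ht hr hi
  have hb : 0 ≤ F.supp t (∑ i ∈ r, i) := by
    rw [map_sum]; exact Finset.sum_nonneg hrt
  have hr0 : F.supp r (∑ i ∈ r, i) = 0 := by
    rw [map_sum]; exact Finset.sum_eq_zero fun i hi => F.supp_self r hr i hi
  have key := F.apply_eq ht (F.supp r) (∑ i ∈ r, i)
  rw [hr0, F.supp_center r hr, mul_one] at key
  have hs : 0 ≤ ∑ i ∈ t, F.coord t i (∑ i ∈ r, i) * F.supp r i :=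
    Finset.sum_nonneg fun i hi => mul_nonneg (hpos i hi) (F.supp_nonneg hr ht hi)
  have hz : F.supp t (∑ i ∈ r, i) = 0 := by linarith
  rw [map_sum, Finset.sum_eq_zero_iff_of_nonneg hrt] at hz
  rwa [F.subset_of_supp_eq_zero ht hr hz]

end FacetSystem

/-- A facet system with volumes `vol` of the facets (completed by the center) and a vector `gen`
in general position. -/
structure GenericFacetSystem (V : Type*) [AddCommGroup V] [Module ℝ V] (d : ℕ) extends
    FacetSystem V d where
  vol : Finset V → ℝ
  gen : V
  vol_pos : ∀ t ∈ facets, 0 < vol t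
  vol_nb : ∀ t ∈ facets, ∀ k ∈ t, vol (toFacetSystem.nb t k)
    = -(coord t k (toFacetSystem.opp t k) * vol t)
  gen_ne : ∀ t ∈ facets, ∀ k ∈ t, coord t k gen ≠ 0

namespace GenericFacetSystem

open scoped Classical

variable {V : Type*} [AddCommGroup V] [Module ℝ V] {d : ℕ} (F : GenericFacetSystem V d)

theorem vol_mul_coord {t : Finset V} (ht : t ∈ F.facets) {k : V} (hk : k ∈ t) :
    F.vol (F.nb t k) * F.coord (F.nb t k) (F.opp t k) F.gen
      = -(F.vol t * F.coord t k F.gen) := by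
  rw [F.vol_nb t ht k hk, F.coord_adj ht hk (F.opp_notMem ht hk) (F.nb_mem ht hk) F.gen]
  simp only [FacetSystem.nb]
  ring

/-- The coordinates of a vector avoiding a proper face are products over complements. -/
noncomputable def wt (τ t : Finset V) : ℝ := (F.vol t * ∏ j ∈ t \ τ, F.coord t j F.gen)⁻¹

/-- The value at `gen` of the linear extension from the facet `t` (and `0` at the center) of a
function on the vertices. -/
noncomputable def ev (t : Finset V) (y : V → ℝ) : ℝ := ∑ i ∈ t, F.coord t i F.gen * y i

/-- The value of the supporting functional at `gen`. -/
noncomputable def height (t : Finset V) : ℝ := F.supp t F.gen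

theorem ev_linear {t : Finset V} (ht : t ∈ F.facets) (f : Dual ℝ V) :
    F.ev t f = f F.gen - F.height t * f F.center := by
  rw [F.apply_eq ht f F.gen, ev, height]; ring

theorem ev_sub (t : Finset V) (x y : V → ℝ) :
    F.ev t (fun i => x i - y i) = F.ev t x - F.ev t y := by
  simp [ev, mul_sub]

theorem prod_ne_zero {τ t : Finset V} (ht : t ∈ F.facets) :
    ∏ j ∈ t \ τ, F.coord t j F.gen ≠ 0 :=
  Finset.prod_ne_zero_iff.2 fun j hj => F.gen_ne t ht j (Finset.mem_sdiff.1 hj).1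

theorem coord_mul_wt {σ t : Finset V} (ht : t ∈ F.facets) {i : V} (hi : i ∈ t \ σ) :
    F.coord t i F.gen * F.wt σ t = F.wt (insert i σ) t := by
  have h1 := F.gen_ne t ht i (Finset.mem_sdiff.1 hi).1
  have h2 := (F.vol_pos t ht).ne'
  have h3 := F.prod_ne_zero (τ := insert i σ) ht
  rw [wt, wt, ← Finset.mul_prod_erase _ _ hi, ← Finset.sdiff_insert]
  field_simp

theorem ev_mul_wt {τ t : Finset V} (ht : t ∈ F.star τ) (hτ : τ.card + 2 = d) {y : V → ℝ}
    (hy : ∀ i ∈ τ, y i = 0) :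
    F.ev t y * F.wt τ t
      = ∑ k ∈ t \ τ, (∑ j ∈ t.erase k \ τ, y j) * (F.vol t * F.coord t k F.gen)⁻¹ := by
  obtain ⟨htF, hτt⟩ := F.mem_star.1 ht
  have hcard : (t \ τ).card = 2 := by
    rw [Finset.card_sdiff_of_subset hτt, F.card_eq t htF]; omega
  obtain ⟨j, k, hjk, hset⟩ := Finset.card_eq_two.1 hcard
  have hev : F.ev t y = F.coord t j F.gen * y j + F.coord t k F.gen * y k := by
    rw [ev, ← Finset.sum_sdiff hτt, hset, Finset.sum_pair hjk,
      Finset.sum_eq_zero (s := τ) fun i hi => by rw [hy i hi, mul_zero], add_zero]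
  have hj : j ∈ t := (Finset.mem_sdiff.1 (hset ▸ Finset.mem_insert_self j {k} : j ∈ t \ τ)).1
  have hk : k ∈ t := (Finset.mem_sdiff.1 (hset ▸ (by simp) : k ∈ t \ τ)).1
  have e1 : t.erase j \ τ = {k} := by
    rw [Finset.erase_sdiff_comm, hset]
    simp [Finset.erase_insert_eq_erase, Finset.erase_eq_of_notMem, hjk]
  have e2 : t.erase k \ τ = {j} := by
    rw [Finset.erase_sdiff_comm, hset, Finset.pair_comm]
    simp [Finset.erase_insert_eq_erase, Finset.erase_eq_of_notMem, hjk.symm]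
  have h1 := F.gen_ne t htF j hj
  have h2 := F.gen_ne t htF k hk
  have h3 := (F.vol_pos t htF).ne'
  rw [hev, wt, hset, Finset.prod_pair hjk, Finset.sum_pair hjk, e1, e2, Finset.sum_singleton,
    Finset.sum_singleton]
  field_simp
  ring

/-- Pairing the two facets at each ridge around a codimension two face. -/
theorem sum_height_mul {τ : Finset V} (g : Finset V → ℝ) (G : Finset V → ℝ) :
    2 * ∑ t ∈ F.star τ, ∑ k ∈ t \ τ, g t * (G (t.erase k) * (F.vol t * F.coord t k F.gen)⁻¹)
      = ∑ t ∈ F.star τ, ∑ k ∈ t \ τ,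
        (g t - g (F.nb t k)) * (G (t.erase k) * (F.vol t * F.coord t k F.gen)⁻¹) := by
  rw [two_mul]
  nth_rewrite 2 [← F.sum_flags_nb τ
    (fun t k => g t * (G (t.erase k) * (F.vol t * F.coord t k F.gen)⁻¹))]
  simp only [← Finset.sum_add_distrib]
  refine Finset.sum_congr rfl fun t ht => Finset.sum_congr rfl fun k hk => ?_
  have htF := (F.mem_star.1 ht).1
  have hkt := (Finset.mem_sdiff.1 hk).1
  rw [F.vol_mul_coord htF hkt, F.nb_erase htF hkt, inv_neg]
  ring

theorem sum_ev_of_vanish {τ : Finset V} (hτ : τ.card + 2 = d) {y : V → ℝ}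
    (hy : ∀ i ∈ τ, y i = 0) : ∑ t ∈ F.star τ, F.ev t y * F.wt τ t = 0 := by
  have h := F.sum_height_mul (τ := τ) (fun _ => 1) (fun ρ => ∑ j ∈ ρ \ τ, y j)
  simp only [sub_self, zero_mul, Finset.sum_const_zero, one_mul] at h
  rw [Finset.sum_congr rfl fun t ht => F.ev_mul_wt ht hτ hy]
  linarith

theorem sum_wt {τ : Finset V} (hτ : τ.card + 2 = d) : ∑ t ∈ F.star τ, F.wt τ t = 0 := by
  rcases (F.star τ).eq_empty_or_nonempty with h | ⟨r, hr⟩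
  · rw [h, Finset.sum_empty]
  obtain ⟨hrF, hτr⟩ := F.mem_star.1 hr
  have : (r \ τ).Nonempty := by
    rw [← Finset.card_pos, Finset.card_sdiff_of_subset hτr, F.card_eq r hrF]; omega
  obtain ⟨k, hk⟩ := this
  rw [Finset.mem_sdiff] at hk
  have h := F.sum_ev_of_vanish hτ (y := F.coord r k) fun i hi =>
    F.coord_ne r hrF k hk.1 i (hτr hi) (fun h => hk.2 (h ▸ hi))
  rw [Finset.sum_congr rfl fun t ht => by
    rw [F.ev_linear (F.mem_star.1 ht).1, F.coord_center r hrF k hk.1, mul_zero, sub_zero],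
    ← Finset.mul_sum] at h
  exact (mul_eq_zero.1 h).resolve_left (F.gen_ne r hrF k hk.1)

theorem sum_height {τ : Finset V} (hτ : τ.card + 2 = d) :
    ∑ t ∈ F.star τ, F.height t * F.wt τ t = 0 := by
  rcases (F.star τ).eq_empty_or_nonempty with h | ⟨r, hr⟩
  · rw [h, Finset.sum_empty]
  obtain ⟨hrF, hτr⟩ := F.mem_star.1 hr
  have h := F.sum_ev_of_vanish hτ (y := F.supp r) fun i hi => F.supp_self r hrF i (hτr hi)
  rw [Finset.sum_congr rfl fun t ht => by
    rw [F.ev_linear (F.mem_star.1 ht).1, F.supp_center r hrF, mul_one, sub_mul],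
    Finset.sum_sub_distrib, ← Finset.mul_sum, F.sum_wt hτ] at h
  linarith

theorem sum_ev {τ : Finset V} (hτ : τ.card + 2 = d) (y : V → ℝ) :
    ∑ t ∈ F.star τ, F.ev t y * F.wt τ t = 0 := by
  rcases (F.star τ).eq_empty_or_nonempty with h | ⟨r, hr⟩
  · rw [h, Finset.sum_empty]
  obtain ⟨hrF, hτr⟩ := F.mem_star.1 hr
  set f : Dual ℝ V := ∑ i ∈ r, y i • F.coord r i with hf
  have hfc : f F.center = 0 := by
    simp only [hf, LinearMap.sum_apply, LinearMap.smul_apply]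
    exact Finset.sum_eq_zero fun i hi => by rw [F.coord_center r hrF i hi, smul_zero]
  have hfi : ∀ i ∈ τ, y i - f i = 0 := by
    intro i hi
    simp only [hf, LinearMap.sum_apply, LinearMap.smul_apply]
    rw [Finset.sum_eq_single_of_mem i (hτr hi), F.coord_self r hrF i (hτr hi)]
    · simp
    · intro j hj hji
      rw [F.coord_ne r hrF j hj i (hτr hi) hji.symm, smul_zero]
  have h := F.sum_ev_of_vanish hτ (y := fun i => y i - f i) hfi
  rw [Finset.sum_congr rfl fun t ht => by
    rw [F.ev_sub, F.ev_linear (F.mem_star.1 ht).1, hfc, mul_zero, sub_zero, sub_mul],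
    Finset.sum_sub_distrib, ← Finset.mul_sum, F.sum_wt hτ] at h
  linarith

theorem height_sub {t : Finset V} (ht : t ∈ F.facets) {k : V} (hk : k ∈ t) :
    F.height t - F.height (F.nb t k) = -(F.supp (F.nb t k) k * F.coord t k F.gen) := by
  have := F.supp_adj ht hk (F.nb_mem ht hk) F.gen
  rw [height, height, FacetSystem.nb, this]; ring

theorem sum_height_ev_of_vanish {τ : Finset V} (hτ : τ.card + 2 = d) {y : V → ℝ}
    (hy : ∀ i ∈ τ, y i = 0) :
    2 * ∑ t ∈ F.star τ, F.height t * F.ev t y * F.wt τ t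
      = -∑ t ∈ F.star τ, ∑ k ∈ t \ τ,
        (∑ j ∈ t.erase k \ τ, y j) * (F.supp (F.nb t k) k * (F.vol t)⁻¹) := by
  rw [Finset.sum_congr rfl fun t ht => by rw [mul_assoc, F.ev_mul_wt ht hτ hy, Finset.mul_sum],
    F.sum_height_mul F.height (fun ρ => ∑ j ∈ ρ \ τ, y j), ← Finset.sum_neg_distrib]
  refine Finset.sum_congr rfl fun t ht => ?_
  rw [← Finset.sum_neg_distrib]
  refine Finset.sum_congr rfl fun k hk => ?_
  have htF := (F.mem_star.1 ht).1
  have hkt := (Finset.mem_sdiff.1 hk).1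
  have h1 := F.gen_ne t htF k hkt
  have h3 := (F.vol_pos t htF).ne'
  rw [F.height_sub htF hkt]
  field_simp

/-- The polygon form is positive at the support function itself. -/
theorem sum_height_height_pos {τ : Finset V} (hτ : τ.card + 2 = d) (hne : (F.star τ).Nonempty) :
    0 < ∑ t ∈ F.star τ, F.height t * F.height t * F.wt τ t := by
  obtain ⟨r, hr⟩ := hne
  obtain ⟨hrF, hτr⟩ := F.mem_star.1 hr
  have h := F.sum_height_ev_of_vanish hτ (y := F.supp r) fun i hi => F.supp_self r hrF i (hτr hi)
  have e : ∑ t ∈ F.star τ, F.height t * F.ev t (F.supp r) * F.wt τ t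
      = -∑ t ∈ F.star τ, F.height t * F.height t * F.wt τ t := by
    rw [Finset.sum_congr rfl fun t ht => by
      rw [F.ev_linear (F.mem_star.1 ht).1, F.supp_center r hrF, mul_one,
        show F.height t * (F.supp r F.gen - F.height t) * F.wt τ t
          = F.supp r F.gen * (F.height t * F.wt τ t) - F.height t * F.height t * F.wt τ t by ring],
      Finset.sum_sub_distrib, ← Finset.mul_sum, F.sum_height hτ]
    ring
  have hterm : ∀ t ∈ F.star τ, ∀ k ∈ t \ τ,
      0 ≤ (∑ j ∈ t.erase k \ τ, F.supp r j) * (F.supp (F.nb t k) k * (F.vol t)⁻¹) := by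
    intro t ht k hk
    have htF := (F.mem_star.1 ht).1
    have hkt := (Finset.mem_sdiff.1 hk).1
    refine mul_nonneg (Finset.sum_nonneg fun j hj => F.supp_nonneg hrF htF ?_)
      (mul_nonneg (F.supp_nonneg (F.nb_mem htF hkt) htF hkt) (inv_nonneg.2 (F.vol_pos t htF).le))
    exact Finset.mem_of_mem_erase (Finset.mem_sdiff.1 hj).1
  have hpos : 0 < ∑ t ∈ F.star τ, ∑ k ∈ t \ τ,
      (∑ j ∈ t.erase k \ τ, F.supp r j) * (F.supp (F.nb t k) k * (F.vol t)⁻¹) := by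
    have hcard : (r \ τ).card = 2 := by
      rw [Finset.card_sdiff_of_subset hτr, F.card_eq r hrF]; omega
    obtain ⟨j, k, hjk, hset⟩ := Finset.card_eq_two.1 hcard
    have hj : j ∈ r \ τ := by simp [hset]
    have hk : k ∈ r \ τ := by simp [hset]
    have hjr := (Finset.mem_sdiff.1 hj).1
    have hkr := (Finset.mem_sdiff.1 hk).1
    have hs := F.nb_mem_star hr hj
    have hks : k ∈ F.nb r j \ τ := by
      refine Finset.mem_sdiff.2 ⟨Finset.mem_insert_of_mem ?_, (Finset.mem_sdiff.1 hk).2⟩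
      exact Finset.mem_erase.2 ⟨hjk.symm, hkr⟩
    have hsF := (F.mem_star.1 hs).1
    refine Finset.sum_pos' (fun t ht => Finset.sum_nonneg (hterm t ht)) ⟨_, hs, ?_⟩
    refine Finset.sum_pos' (hterm _ hs) ⟨k, hks, ?_⟩
    have hkn := (Finset.mem_sdiff.1 hks).1
    refine mul_pos (Finset.sum_pos' (fun i hi => F.supp_nonneg hrF hsF
      (Finset.mem_of_mem_erase (Finset.mem_sdiff.1 hi).1)) ⟨F.opp r j, ?_, ?_⟩)
      (mul_pos ?_ (inv_pos.2 (F.vol_pos _ hsF)))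
    · refine Finset.mem_sdiff.2 ⟨Finset.mem_erase.2 ⟨?_, F.opp_mem_nb r j⟩,
        (Finset.mem_sdiff.1 (F.opp_mem_sdiff hr hj)).2⟩
      exact fun h => F.opp_notMem hrF hjr (h ▸ hkr)
    · exact F.supp_pos r hrF _ hsF _ (F.opp_mem_nb r j) (F.opp_notMem hrF hjr)
    · exact F.supp_pos _ (F.nb_mem hsF hkn) _ hsF k hkn (F.notMem_nb hsF hkn)
  rw [e] at h
  linarith

theorem height_eq {t s τ : Finset V} (ht : t ∈ F.star τ) (hs : s ∈ F.star τ) :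
    F.height s = ∑ i ∈ t \ τ, F.coord t i F.gen * F.supp s i + F.height t := by
  obtain ⟨htF, hτt⟩ := F.mem_star.1 ht
  obtain ⟨hsF, hτs⟩ := F.mem_star.1 hs
  rw [height, F.apply_eq htF, F.supp_center s hsF, mul_one, ← height, ← Finset.sum_sdiff hτt,
    Finset.sum_eq_zero (s := τ) fun i hi => by rw [F.supp_self s hsF i (hτs hi), mul_zero],
    add_zero]

theorem exists_supp_pos {t s τ : Finset V} (ht : t ∈ F.star τ) (hs : s ∈ F.star τ)
    (hne : t ≠ s) : ∃ i ∈ t \ τ, 0 < F.supp s i := by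
  obtain ⟨htF, -⟩ := F.mem_star.1 ht
  obtain ⟨hsF, hτs⟩ := F.mem_star.1 hs
  by_contra! h
  refine hne (F.subset_of_supp_eq_zero hsF htF fun i hi => ?_)
  by_cases hiτ : i ∈ τ
  · exact F.supp_self s hsF i (hτs hiτ)
  · exact (h i (Finset.mem_sdiff.2 ⟨hi, hiτ⟩)).antisymm (F.supp_nonneg hsF htF hi)

theorem height_lt_of_pos {t s τ : Finset V} (ht : t ∈ F.star τ) (hs : s ∈ F.star τ)
    (hpos : ∀ i ∈ t \ τ, 0 < F.coord t i F.gen) (hne : t ≠ s) : F.height t < F.height s := by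
  rw [F.height_eq ht hs, lt_add_iff_pos_left]
  obtain ⟨i, hi, hi'⟩ := F.exists_supp_pos ht hs hne
  exact Finset.sum_pos' (fun j hj => mul_nonneg (hpos j hj).le (F.supp_nonneg
    (F.mem_star.1 hs).1 (F.mem_star.1 ht).1 (Finset.mem_sdiff.1 hj).1))
    ⟨i, hi, mul_pos (hpos i hi) hi'⟩

theorem height_lt_of_neg {t s τ : Finset V} (ht : t ∈ F.star τ) (hs : s ∈ F.star τ)
    (hneg : ∀ i ∈ t \ τ, F.coord t i F.gen < 0) (hne : t ≠ s) : F.height s < F.height t := by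
  rw [F.height_eq ht hs, add_lt_iff_neg_right, ← neg_pos, ← Finset.sum_neg_distrib]
  obtain ⟨i, hi, hi'⟩ := F.exists_supp_pos ht hs hne
  refine Finset.sum_pos' (fun j hj => ?_) ⟨i, hi, ?_⟩
  · rw [← neg_mul]
    exact mul_nonneg (neg_nonneg.2 (hneg j hj).le) (F.supp_nonneg
      (F.mem_star.1 hs).1 (F.mem_star.1 ht).1 (Finset.mem_sdiff.1 hj).1)
  · rw [← neg_mul]
    exact mul_pos (neg_pos.2 (hneg i hi)) hi'

theorem pos_or_neg_of_wt_pos {t τ : Finset V} (hτ : τ.card + 2 = d) (ht : t ∈ F.star τ)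
    (hw : 0 < F.wt τ t) :
    (∀ i ∈ t \ τ, 0 < F.coord t i F.gen) ∨ (∀ i ∈ t \ τ, F.coord t i F.gen < 0) := by
  obtain ⟨htF, hτt⟩ := F.mem_star.1 ht
  have hcard : (t \ τ).card = 2 := by
    rw [Finset.card_sdiff_of_subset hτt, F.card_eq t htF]; omega
  obtain ⟨j, k, hjk, hset⟩ := Finset.card_eq_two.1 hcard
  rw [wt, hset, Finset.prod_pair hjk, inv_pos] at hw
  have := (mul_pos_iff_of_pos_left (F.vol_pos t htF)).1 hw
  rw [hset]
  rcases mul_pos_iff.1 this with h | h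
  · left; simpa using h
  · right; simpa using h

/-- Adding a multiple of the support function and a linear function, one can make a piecewise
linear function vanish on the two cones with positive weight. -/
theorem exists_normalization {τ : Finset V} (hτ : τ.card + 2 = d) (e : Finset V → ℝ) :
    ∃ c b : ℝ, ∀ t ∈ F.star τ, 0 < F.wt τ t → e t + c * F.height t + b = 0 := by
  by_cases hp : ∃ p ∈ F.star τ, ∀ i ∈ p \ τ, 0 < F.coord p i F.gen
  · obtain ⟨p, hp, hpp⟩ := hp
    have hpu : ∀ t ∈ F.star τ, (∀ i ∈ t \ τ, 0 < F.coord t i F.gen) → t = p := by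
      intro t ht htp
      by_contra hne
      exact lt_asymm (F.height_lt_of_pos ht hp htp hne)
        (F.height_lt_of_pos hp ht hpp (Ne.symm hne))
    by_cases hn : ∃ n ∈ F.star τ, ∀ i ∈ n \ τ, F.coord n i F.gen < 0
    · obtain ⟨n, hn, hnn⟩ := hn
      have hnu : ∀ t ∈ F.star τ, (∀ i ∈ t \ τ, F.coord t i F.gen < 0) → t = n := by
        intro t ht htn
        by_contra hne
        exact lt_asymm (F.height_lt_of_neg ht hn htn hne)
          (F.height_lt_of_neg hn ht hnn (Ne.symm hne))
      have hne : p ≠ n := by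
        rintro rfl
        obtain ⟨hpF, hτp⟩ := F.mem_star.1 hp
        have : (p \ τ).Nonempty := by
          rw [← Finset.card_pos, Finset.card_sdiff_of_subset hτp, F.card_eq p hpF]; omega
        obtain ⟨i, hi⟩ := this
        exact lt_asymm (hpp i hi) (hnn i hi)
      have hlt : F.height n - F.height p ≠ 0 :=
        (sub_pos.2 (F.height_lt_of_pos hp hn hpp hne)).ne'
      refine ⟨(e p - e n) / (F.height n - F.height p),
        -e p - (e p - e n) / (F.height n - F.height p) * F.height p, fun t ht hw => ?_⟩
      rcases F.pos_or_neg_of_wt_pos hτ ht hw with h | h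
      · rw [hpu t ht h]; ring
      · rw [hnu t ht h]; field_simp; ring
    · refine ⟨0, -e p, fun t ht hw => ?_⟩
      rcases F.pos_or_neg_of_wt_pos hτ ht hw with h | h
      · rw [hpu t ht h]; ring
      · exact absurd ⟨t, ht, h⟩ hn
  · by_cases hn : ∃ n ∈ F.star τ, ∀ i ∈ n \ τ, F.coord n i F.gen < 0
    · obtain ⟨n, hn, hnn⟩ := hn
      refine ⟨0, -e n, fun t ht hw => ?_⟩
      rcases F.pos_or_neg_of_wt_pos hτ ht hw with h | h
      · exact absurd ⟨t, ht, h⟩ hp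
      · have : t = n := by
          by_contra hne
          exact lt_asymm (F.height_lt_of_neg ht hn h hne)
            (F.height_lt_of_neg hn ht hnn (Ne.symm hne))
        rw [this]; ring
    · refine ⟨0, 0, fun t ht hw => ?_⟩
      rcases F.pos_or_neg_of_wt_pos hτ ht hw with h | h
      · exact absurd ⟨t, ht, h⟩ hp
      · exact absurd ⟨t, ht, h⟩ hn

/-- Minkowski's inequality for polygons, with its equality case, for functions orthogonal to the
support function. -/
theorem polygon_form {τ : Finset V} (hτ : τ.card + 2 = d) {x : V → ℝ}
    (hx : ∑ t ∈ F.star τ, F.height t * F.ev t x * F.wt τ t = 0) :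
    ∑ t ∈ F.star τ, F.ev t x ^ 2 * F.wt τ t ≤ 0 ∧
      (∑ t ∈ F.star τ, F.ev t x ^ 2 * F.wt τ t = 0 →
        ∃ b, ∀ t ∈ F.star τ, F.ev t x = b) := by
  rcases (F.star τ).eq_empty_or_nonempty with h | hne
  · simp [h]
  obtain ⟨c, b, hcb⟩ := F.exists_normalization hτ (fun t => F.ev t x)
  have hexp : ∑ t ∈ F.star τ, (F.ev t x + c * F.height t + b) ^ 2 * F.wt τ t
      = ∑ t ∈ F.star τ, F.ev t x ^ 2 * F.wt τ t
        + c ^ 2 * ∑ t ∈ F.star τ, F.height t * F.height t * F.wt τ t := by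
    have : ∀ t ∈ F.star τ, (F.ev t x + c * F.height t + b) ^ 2 * F.wt τ t
        = F.ev t x ^ 2 * F.wt τ t + c ^ 2 * (F.height t * F.height t * F.wt τ t)
          + 2 * c * (F.height t * F.ev t x * F.wt τ t) + 2 * b * (F.ev t x * F.wt τ t)
          + 2 * c * b * (F.height t * F.wt τ t) + b ^ 2 * F.wt τ t := fun t _ => by ring
    rw [Finset.sum_congr rfl this]
    simp only [Finset.sum_add_distrib, ← Finset.mul_sum]
    rw [hx, F.sum_ev hτ, F.sum_height hτ, F.sum_wt hτ]
    ring
  have hterm : ∀ t ∈ F.star τ, (F.ev t x + c * F.height t + b) ^ 2 * F.wt τ t ≤ 0 := by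
    intro t ht
    rcases le_or_gt (F.wt τ t) 0 with h | h
    · exact mul_nonpos_of_nonneg_of_nonpos (sq_nonneg _) h
    · rw [hcb t ht h]; simp
  have hpos := F.sum_height_height_pos hτ hne
  have hle := Finset.sum_nonpos hterm
  rw [hexp] at hle
  have hc2 := mul_nonneg (sq_nonneg c) hpos.le
  refine ⟨by linarith, fun h0 => ?_⟩
  rw [h0, zero_add] at hle hexp
  have hc : c = 0 := by
    have : c ^ 2 = 0 := (mul_eq_zero.1 (hle.antisymm hc2)).resolve_right hpos.ne'
    exact pow_eq_zero_iff (two_ne_zero) |>.1 this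
  rw [hc, zero_pow two_ne_zero, zero_mul, Finset.sum_eq_zero_iff_of_nonpos
    (by simpa only [hc] using hterm)] at hexp
  refine ⟨-b, fun t ht => ?_⟩
  have h1 := hexp t ht
  have hw : F.wt τ t ≠ 0 := inv_ne_zero (mul_ne_zero (F.vol_pos t (F.mem_star.1 ht).1).ne'
    (F.prod_ne_zero (F.mem_star.1 ht).1))
  have h2 := (pow_eq_zero_iff two_ne_zero).1 ((mul_eq_zero.1 h1).resolve_right hw)
  linarith

end GenericFacetSystem

namespace FacetSystem

open scoped Classical

variable {V : Type*} [AddCommGroup V] [Module ℝ V] {d : ℕ} (F : FacetSystem V d)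

/-- Infinitesimal motions of the cone over the edge graph, in homogeneous form. -/
def IsMotion (u : V → Dual ℝ V) : Prop :=
  ∀ t ∈ F.facets, ∀ i ∈ t, ∀ j ∈ t, u i j + u j i = 0

variable {F}

theorem IsMotion.exists_alternating {u : V → Dual ℝ V} (hu : F.IsMotion u) {t : Finset V}
    (ht : t ∈ F.facets) :
    ∃ S : V →ₗ[ℝ] Dual ℝ V, (∀ v w, S v w + S w v = 0) ∧ ∀ i ∈ t, S i = u i := by
  let S : V →ₗ[ℝ] Dual ℝ V := ∑ i ∈ t, ((F.coord t i).smulRight (u i)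
    - (F.supp t).smulRight (u i F.center • F.coord t i))
  have hS : ∀ v w, S v w = ∑ i ∈ t, (F.coord t i v * u i w
      - F.supp t v * (u i F.center * F.coord t i w)) := by
    intro v w
    simp [S, LinearMap.sum_apply]
  refine ⟨S, fun v w => ?_, fun i hi => LinearMap.ext fun w => ?_⟩
  · have h1 : ∀ v w, S v w = ∑ i ∈ t, ∑ j ∈ t, F.coord t i v * F.coord t j w * u i j
        + ∑ i ∈ t, u i F.center * (F.coord t i v * F.supp t w - F.supp t v * F.coord t i w) := by
      intro v w
      rw [hS, ← Finset.sum_add_distrib]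
      refine Finset.sum_congr rfl fun i hi => ?_
      rw [F.apply_eq ht (u i) w, mul_add, Finset.mul_sum]
      have : ∑ j ∈ t, F.coord t i v * F.coord t j w * u i j
          = ∑ j ∈ t, F.coord t i v * (F.coord t j w * u i j) :=
        Finset.sum_congr rfl fun j _ => mul_assoc _ _ _
      rw [this]
      ring
    rw [h1 v w, h1 w v]
    have h2 : ∑ i ∈ t, ∑ j ∈ t, F.coord t i w * F.coord t j v * u i j
        = -∑ i ∈ t, ∑ j ∈ t, F.coord t i v * F.coord t j w * u i j := by
      rw [Finset.sum_comm, ← Finset.sum_neg_distrib]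
      refine Finset.sum_congr rfl fun i hi => ?_
      rw [← Finset.sum_neg_distrib]
      refine Finset.sum_congr rfl fun j hj => ?_
      rw [eq_neg_of_add_eq_zero_left (hu t ht j hj i hi)]
      ring
    have h3 : ∑ i ∈ t, u i F.center * (F.coord t i w * F.supp t v - F.supp t w * F.coord t i v)
        = -∑ i ∈ t, u i F.center * (F.coord t i v * F.supp t w - F.supp t v * F.coord t i w) := by
      rw [← Finset.sum_neg_distrib]
      exact Finset.sum_congr rfl fun i _ => by ring
    rw [h2, h3]
    ring
  · rw [hS, Finset.sum_eq_single_of_mem i hi, F.coord_self t ht i hi, F.supp_self t ht i hi]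
    · ring
    · intro j hj hji
      rw [F.coord_ne t ht j hj i hi hji.symm, F.supp_self t ht i hi]
      ring

end FacetSystem

namespace GenericFacetSystem

open scoped Classical

variable {V : Type*} [AddCommGroup V] [Module ℝ V] {d : ℕ} (F : GenericFacetSystem V d)

theorem motion_sum_of_vanish {u : V → Dual ℝ V} (hu : F.IsMotion u) {τ : Finset V}
    (hτ : τ.card + 2 = d) (h0 : ∀ i ∈ τ, u i = 0) :
    ∑ t ∈ F.star τ, F.height t * F.ev t (fun i => u i F.center) * F.wt τ t = 0 := by
  have h := F.sum_height_ev_of_vanish hτ (y := fun i => u i F.center)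
    (fun i hi => by rw [h0 i hi, LinearMap.zero_apply])
  let H : Finset V → V → ℝ := fun t k => ∑ j ∈ t.erase k \ τ, u j k * (F.vol t)⁻¹
  have hflag : ∀ t ∈ F.star τ, ∀ k ∈ t \ τ,
      (∑ j ∈ t.erase k \ τ, u j F.center) * (F.supp (F.nb t k) k * (F.vol t)⁻¹)
        = H (F.nb t k) (F.opp t k) + H t k := by
    intro t ht k hk
    obtain ⟨htF, hτt⟩ := F.mem_star.1 ht
    have hkt := (Finset.mem_sdiff.1 hk).1
    simp only [H]
    rw [F.nb_erase htF hkt, ← Finset.sum_add_distrib, Finset.sum_mul]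
    refine Finset.sum_congr rfl fun j hj => ?_
    have hjt := Finset.mem_of_mem_erase (Finset.mem_sdiff.1 hj).1
    have hvan : ∀ i ∈ t.erase k, u j i = 0 := by
      intro i hi
      have hit := Finset.mem_of_mem_erase hi
      have hanti := hu t htF j hjt i hit
      by_cases hiτ : i ∈ τ
      · rw [h0 i hiτ, LinearMap.zero_apply, add_zero] at hanti
        exact hanti
      · have hcard : (t.erase k \ τ).card ≤ 1 := by
          rw [Finset.erase_sdiff_comm, Finset.card_erase_of_mem hk,
            Finset.card_sdiff_of_subset hτt, F.card_eq t htF]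
          omega
        have hij : i = j := Finset.card_le_one.1 hcard i (Finset.mem_sdiff.2 ⟨hi, hiτ⟩) j hj
        subst hij
        linarith
    have e1 := F.apply_eq_of_erase htF hkt hvan (F.opp t k)
    have e2 := F.supp_new_eq htF hkt (F.nb_mem htF hkt)
    have e3 := F.coord_new_neg htF hkt (F.opp_notMem htF hkt) (F.nb_mem htF hkt)
    rw [← FacetSystem.nb] at e2
    rw [e1, e2, F.vol_nb t htF k hkt]
    have h3 := (F.vol_pos t htF).ne'
    have h4 := e3.ne
    field_simp
    ring
  rw [Finset.sum_congr rfl fun t ht => Finset.sum_congr rfl fun k hk => hflag t ht k hk] at h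
  simp only [Finset.sum_add_distrib] at h
  rw [F.sum_flags_nb τ H] at h
  have hH : ∑ t ∈ F.star τ, ∑ k ∈ t \ τ, H t k = 0 := by
    refine Finset.sum_eq_zero fun t ht => ?_
    obtain ⟨htF, -⟩ := F.mem_star.1 ht
    have e1 : ∀ k ∈ t \ τ, H t k = (∑ j ∈ t \ τ, u j k) * (F.vol t)⁻¹ := by
      intro k hk
      have := hu t htF k (Finset.mem_sdiff.1 hk).1 k (Finset.mem_sdiff.1 hk).1
      simp only [H]
      rw [Finset.sum_mul, Finset.erase_sdiff_comm, ← Finset.add_sum_erase _ _ hk,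
        show u k k = 0 by linarith]
      ring
    rw [Finset.sum_congr rfl e1, ← Finset.sum_mul]
    have e2 : ∑ k ∈ t \ τ, ∑ j ∈ t \ τ, u j k = -∑ k ∈ t \ τ, ∑ j ∈ t \ τ, u j k := by
      conv_lhs => rw [Finset.sum_comm]
      rw [← Finset.sum_neg_distrib]
      refine Finset.sum_congr rfl fun i hi => ?_
      rw [← Finset.sum_neg_distrib]
      exact Finset.sum_congr rfl fun j hj => eq_neg_of_add_eq_zero_left
        (hu t htF i (Finset.mem_sdiff.1 hi).1 j (Finset.mem_sdiff.1 hj).1)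
    rw [show ∑ k ∈ t \ τ, ∑ j ∈ t \ τ, u j k = 0 by linarith, zero_mul]
  rw [hH] at h
  linarith

theorem motion_sum {u : V → Dual ℝ V} (hu : F.IsMotion u) {τ : Finset V}
    (hτ : τ.card + 2 = d) :
    ∑ t ∈ F.star τ, F.height t * F.ev t (fun i => u i F.center) * F.wt τ t = 0 := by
  rcases (F.star τ).eq_empty_or_nonempty with h | ⟨r, hr⟩
  · rw [h, Finset.sum_empty]
  obtain ⟨hrF, hτr⟩ := F.mem_star.1 hr
  obtain ⟨S, hS, hSu⟩ := hu.exists_alternating hrF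
  have hS0 : S F.center F.center = 0 := by have := hS F.center F.center; linarith
  have h := F.motion_sum_of_vanish (u := fun i => u i - S i) (fun t ht i hi j hj => by
    have h1 := hu t ht i hi j hj
    have h2 := hS i j
    simp only [LinearMap.sub_apply]
    linarith) hτ (fun i hi => by rw [hSu i (hτr hi), sub_self])
  simp only [LinearMap.sub_apply] at h
  have e : ∀ t ∈ F.star τ, F.ev t (fun i => u i F.center - S i F.center)
      = F.ev t (fun i => u i F.center) - S F.gen F.center := by
    intro t ht
    have := F.ev_linear (F.mem_star.1 ht).1 (S.flip F.center)
    rw [LinearMap.flip_apply, LinearMap.flip_apply, hS0, mul_zero, sub_zero] at this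
    rw [F.ev_sub, ← this]
    rfl
  rw [Finset.sum_congr rfl fun t ht => by
    rw [e t ht, show F.height t * (F.ev t (fun i => u i F.center) - S F.gen F.center) * F.wt τ t
      = F.height t * F.ev t (fun i => u i F.center) * F.wt τ t
        - S F.gen F.center * (F.height t * F.wt τ t) by ring],
    Finset.sum_sub_distrib, ← Finset.mul_sum, F.sum_height hτ] at h
  linarith

theorem sum_star_eq {σ : Finset V} {y : V → ℝ} (hy : ∀ i ∈ σ, y i = 0) (g : Finset V → ℝ) :
    ∑ t ∈ F.star σ, F.ev t y * g t * F.wt σ t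
      = ∑ i ∈ F.facets.biUnion id \ σ,
        y i * ∑ t ∈ F.star (insert i σ), g t * F.wt (insert i σ) t := by
  simp only [Finset.mul_sum]
  rw [Finset.sum_comm' (t' := F.star σ) (s' := fun t => t \ σ)]
  · refine Finset.sum_congr rfl fun t ht => ?_
    obtain ⟨htF, hσt⟩ := F.mem_star.1 ht
    rw [ev, ← Finset.sum_sdiff hσt, Finset.sum_eq_zero (s := σ) fun i hi => by
      rw [hy i hi, mul_zero], add_zero, mul_assoc, Finset.sum_mul]
    refine Finset.sum_congr rfl fun i hi => ?_
    rw [← F.coord_mul_wt htF hi]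
    ring
  · intro i t
    simp only [Finset.mem_sdiff, Finset.mem_biUnion, FacetSystem.mem_star, id,
      Finset.insert_subset_iff]
    constructor
    · rintro ⟨⟨-, h1⟩, h2, h3, h4⟩
      exact ⟨⟨h3, h1⟩, h2, h4⟩
    · rintro ⟨⟨h3, h1⟩, h2, h4⟩
      exact ⟨⟨⟨t, h2, h3⟩, h1⟩, h2, h3, h4⟩

/-- A motion vanishing on a facet vanishes on the adjacent facets. -/
theorem motion_nb {u : V → Dual ℝ V} (hu : F.IsMotion u) (hd : 3 ≤ d) {t : Finset V}
    (ht : t ∈ F.facets) (h0 : ∀ i ∈ t, u i = 0) {k : V} (hk : k ∈ t) :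
    ∀ i ∈ F.nb t k, u i = 0 := by
  have hc := F.card_eq t ht
  have c1 : (t.erase k).card = d - 1 := by rw [Finset.card_erase_of_mem hk, hc]
  obtain ⟨j, hj⟩ : (t.erase k).Nonempty := by rw [← Finset.card_pos]; omega
  have c2 : ((t.erase k).erase j).card = d - 2 := by rw [Finset.card_erase_of_mem hj, c1]; omega
  obtain ⟨i, hi⟩ : ((t.erase k).erase j).Nonempty := by rw [← Finset.card_pos]; omega
  set τ := (t.erase k).erase j with hτdef
  have hτ : τ.card + 2 = d := by omega
  have hτρ : τ ⊆ t.erase k := Finset.erase_subset _ _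
  have hτt : τ ⊆ t := hτρ.trans (Finset.erase_subset _ _)
  have hit := hτt hi
  set σ := τ.erase i with hσdef
  have hσ : σ.card + 3 = d := by rw [hσdef, Finset.card_erase_of_mem hi]; omega
  have hσt : σ ⊆ t := (Finset.erase_subset _ _).trans hτt
  have hins : insert i σ = τ := Finset.insert_erase hi
  let x : V → ℝ := fun i => u i F.center
  have hx0 : ∀ i ∈ t, x i = 0 := fun i hi => by simp only [x]; rw [h0 i hi, LinearMap.zero_apply]
  have hxσ : ∀ i ∈ σ, x i = 0 := fun i hi => hx0 i (hσt hi)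
  have hcard : ∀ m ∈ F.facets.biUnion id \ σ, (insert m σ).card + 2 = d := by
    intro m hm
    rw [Finset.card_insert_of_notMem (Finset.mem_sdiff.1 hm).2]; omega
  have horth : ∀ m ∈ F.facets.biUnion id \ σ, ∑ t ∈ F.star (insert m σ),
      F.height t * F.ev t x * F.wt (insert m σ) t = 0 :=
    fun m hm => F.motion_sum hu (hcard m hm)
  have hr := F.nb_mem ht hit
  have hσr : ∀ m ∈ σ, m ∈ F.nb t i := fun m hm => Finset.mem_insert_of_mem
    (Finset.mem_erase.2 ⟨Finset.ne_of_mem_erase hm, hσt hm⟩)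
  have s1 := F.sum_star_eq hxσ (fun t => F.height t * F.ev t x)
  rw [Finset.sum_eq_zero (s := F.facets.biUnion id \ σ)
    fun m hm => by rw [horth m hm, mul_zero]] at s1
  have s2 := F.sum_star_eq hxσ (fun t => F.ev t x)
  rw [Finset.sum_eq_zero (s := F.facets.biUnion id \ σ)
    fun m hm => by rw [F.sum_ev (hcard m hm), mul_zero]] at s2
  have s3 := F.sum_star_eq (σ := σ) (y := F.supp (F.nb t i))
    (fun m hm => F.supp_self _ hr m (hσr m hm)) (fun t => F.ev t x ^ 2)
  rw [Finset.sum_congr rfl fun t ht => by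
    rw [F.ev_linear (F.mem_star.1 ht).1, F.supp_center _ hr, mul_one,
      show (F.supp (F.nb _ i) F.gen - F.height t) * F.ev t x ^ 2 * F.wt σ t
        = F.supp (F.nb _ i) F.gen * (F.ev t x * F.ev t x * F.wt σ t)
          - F.ev t x * (F.height t * F.ev t x) * F.wt σ t by ring],
    Finset.sum_sub_distrib, ← Finset.mul_sum, s1, s2, mul_zero, sub_zero] at s3
  have hterm : ∀ m ∈ F.facets.biUnion id \ σ, F.supp (F.nb t i) m *
      ∑ t ∈ F.star (insert m σ), F.ev t x ^ 2 * F.wt (insert m σ) t ≤ 0 := by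
    intro m hm
    obtain ⟨s, hs, hms⟩ := Finset.mem_biUnion.1 (Finset.mem_sdiff.1 hm).1
    exact mul_nonpos_of_nonneg_of_nonpos (F.supp_nonneg hr hs hms)
      (F.polygon_form (hcard m hm) (horth m hm)).1
  have hiX : i ∈ F.facets.biUnion id \ σ := Finset.mem_sdiff.2
    ⟨Finset.mem_biUnion.2 ⟨t, ht, hit⟩, Finset.notMem_erase _ _⟩
  have hz := (Finset.sum_eq_zero_iff_of_nonpos hterm).1 s3.symm i hiX
  have hz' := (mul_eq_zero.1 hz).resolve_left
    (F.supp_pos _ hr t ht i hit (F.notMem_nb ht hit)).ne'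
  obtain ⟨b, hb⟩ := (F.polygon_form (hcard i hiX) (horth i hiX)).2 hz'
  rw [hins] at hb
  have htτ : t ∈ F.star τ := F.mem_star.2 ⟨ht, hτt⟩
  have hkτ : k ∈ t \ τ := Finset.mem_sdiff.2 ⟨hk, fun h => Finset.notMem_erase k t (hτρ h)⟩
  have hs := F.nb_mem ht hk
  have hl := F.opp_mem_nb t k
  have e1 : F.ev t x = 0 := Finset.sum_eq_zero fun m hm => by rw [hx0 m hm, mul_zero]
  have e2 : F.ev (F.nb t k) x = F.coord (F.nb t k) (F.opp t k) F.gen * x (F.opp t k) := by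
    rw [ev, ← Finset.add_sum_erase _ _ hl, F.nb_erase ht hk, Finset.sum_eq_zero
      (s := t.erase k) fun m hm => by rw [hx0 m (Finset.mem_of_mem_erase hm), mul_zero], add_zero]
  rw [hb _ (F.nb_mem_star htτ hkτ), ← hb t htτ, e1] at e2
  have hxl : x (F.opp t k) = 0 := (mul_eq_zero.1 e2.symm).resolve_left (F.gen_ne _ hs _ hl)
  intro m hm
  rcases Finset.mem_insert.1 hm with rfl | hm
  · refine LinearMap.ext fun v => ?_
    rw [F.apply_eq hs, show u (F.opp t k) F.center = 0 from hxl, mul_zero, add_zero,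
      LinearMap.zero_apply]
    refine Finset.sum_eq_zero fun m hm => ?_
    have hanti := hu _ hs _ hl m hm
    rcases Finset.mem_insert.1 hm with rfl | hm
    · rw [show u (F.opp t k) (F.opp t k) = 0 by linarith, mul_zero]
    · rw [h0 m (Finset.mem_of_mem_erase hm), LinearMap.zero_apply, add_zero] at hanti
      rw [hanti, mul_zero]
  · exact h0 m (Finset.mem_of_mem_erase hm)

/-- Infinitesimal rigidity: a motion vanishing on one facet vanishes on all vertices. -/
theorem motion_eq_zero {u : V → Dual ℝ V} (hu : F.IsMotion u) (hd : 3 ≤ d) {t₀ : Finset V}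
    (ht₀ : t₀ ∈ F.facets) (h0 : ∀ i ∈ t₀, u i = 0) :
    ∀ t ∈ F.facets, ∀ i ∈ t, u i = 0 :=
  F.facets_connected (C := fun t => ∀ i ∈ t, u i = 0) ht₀ h0
    fun _ ht h _ hk => F.motion_nb hu hd ht h hk

end GenericFacetSystem

namespace FacetSystem

open scoped Classical

theorem exists_perm_of_range_eq {ι α : Type*} [Finite ι] {v w : ι → α}
    (hv : Function.Injective v) (hw : Function.Injective w) (h : Set.range v = Set.range w) :
    ∃ σ : Equiv.Perm ι, w = v ∘ σ := by
  refine ⟨(Equiv.ofInjective w hw).trans ((Equiv.setCongr h.symm).trans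
    (Equiv.ofInjective v hv).symm), funext fun i => ?_⟩
  simp [Equiv.apply_ofInjective_symm]

variable {V : Type*} [AddCommGroup V] [Module ℝ V] {d : ℕ} (F : FacetSystem V d)

theorem abs_det_eq_of_range_eq {n : ℕ} (e : Basis (Fin n) ℝ V) {v w : Fin n → V}
    (hv : Function.Injective v) (hw : Function.Injective w) (h : Set.range v = Set.range w) :
    |e.det v| = |e.det w| := by
  obtain ⟨σ, rfl⟩ := exists_perm_of_range_eq hv hw h
  rw [AlternatingMap.map_perm]
  rcases Int.units_eq_one_or (Equiv.Perm.sign σ) with h | h <;> simp [h]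

theorem center_notMem {t : Finset V} (ht : t ∈ F.facets) : F.center ∉ t := fun h => by
  have := F.supp_self t ht _ h
  rw [F.supp_center t ht] at this
  exact one_ne_zero this

theorem top_le_span {t : Finset V} (ht : t ∈ F.facets) :
    ⊤ ≤ Submodule.span ℝ (insert F.center (t : Set V)) := by
  intro v _
  rw [F.expand t ht v]
  exact add_mem (sum_mem fun i hi => Submodule.smul_mem _ _
    (Submodule.subset_span (Set.mem_insert_of_mem _ hi)))
    (Submodule.smul_mem _ _ (Submodule.subset_span (Set.mem_insert _ _)))

theorem det_ne_zero {t : Finset V} (ht : t ∈ F.facets) (e : Basis (Fin (d + 1)) ℝ V)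
    {v : Fin d → V} (hv : Set.range v = t) :
    e.det (Fin.cons F.center v : Fin (d + 1) → V) ≠ 0 := by
  have hspan : ⊤ ≤ Submodule.span ℝ (Set.range (Fin.cons F.center v : Fin (d + 1) → V)) := by
    rw [Fin.range_cons, hv]
    exact F.top_le_span ht
  refine ((e.is_basis_iff_det).1 ⟨linearIndependent_of_top_le_span_of_card_eq_finrank hspan ?_,
    top_le_iff.1 hspan⟩).ne_zero
  rw [Module.finrank_eq_card_basis e]

theorem det_update {t : Finset V} (ht : t ∈ F.facets) (e : Basis (Fin (d + 1)) ℝ V)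
    {v : Fin d → V} (hv : Set.range v = t) (a : Fin d) (l : V) :
    e.det (Fin.cons F.center (Function.update v a l) : Fin (d + 1) → V)
      = F.coord t (v a) l * e.det (Fin.cons F.center v : Fin (d + 1) → V) := by
  have hmem : v a ∈ t := Finset.mem_coe.1 (hv ▸ Set.mem_range_self a)
  set w : Fin (d + 1) → V := Fin.cons F.center v with hw
  have key := F.apply_eq_of_erase ht hmem
    (f := e.det.toMultilinearMap.toLinearMap w a.succ) (fun i hi => by
      obtain ⟨b, rfl⟩ : i ∈ Set.range v := hv ▸ Finset.mem_of_mem_erase hi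
      have hba : a.succ ≠ b.succ := fun h => Finset.ne_of_mem_erase hi (by
        rw [Fin.succ_injective _ h])
      exact e.det.map_update_self w hba) l
  have hc : e.det.toMultilinearMap.toLinearMap w a.succ F.center = 0 :=
    e.det.map_update_self w (i := a.succ) (j := 0) (Fin.succ_ne_zero a)
  have hs : e.det.toMultilinearMap.toLinearMap w a.succ (v a) = e.det w := by
    change e.det (Function.update w a.succ (w a.succ)) = _
    rw [Function.update_eq_self]
  rw [hc, hs, mul_zero, add_zero] at key
  rw [Fin.cons_update]
  exact key

theorem exists_enum {t : Finset V} (ht : t ∈ F.facets) :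
    ∃ v : Fin d → V, Function.Injective v ∧ Set.range v = t := by
  refine ⟨fun a => ((Finset.equivFinOfCardEq (F.card_eq t ht)).symm a : V),
    Subtype.val_injective.comp (Equiv.injective _), ?_⟩
  ext x
  constructor
  · rintro ⟨a, rfl⟩
    exact Subtype.prop _
  · intro hx
    exact ⟨Finset.equivFinOfCardEq (F.card_eq t ht) ⟨x, hx⟩, by simp⟩

theorem cons_injective {t : Finset V} (ht : t ∈ F.facets) {v : Fin d → V}
    (hi : Function.Injective v) (hv : Set.range v = t) :
    Function.Injective (Fin.cons F.center v : Fin (d + 1) → V) :=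
  Fin.cons_injective_iff.2 ⟨fun h => F.center_notMem ht (Finset.mem_coe.1 (hv ▸ h)), hi⟩

theorem exists_vol [FiniteDimensional ℝ V] (hV : finrank ℝ V = d + 1) :
    ∃ vol : Finset V → ℝ, (∀ t ∈ F.facets, 0 < vol t) ∧
      ∀ t ∈ F.facets, ∀ k ∈ t, vol (F.nb t k) = -(F.coord t k (F.opp t k) * vol t) := by
  have e : Basis (Fin (d + 1)) ℝ V := finBasisOfFinrankEq ℝ V hV
  have henum : ∀ t : Finset V, ∃ v : Fin d → V,
      t ∈ F.facets → Function.Injective v ∧ Set.range v = t := fun t => by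
    by_cases ht : t ∈ F.facets
    · obtain ⟨v, hv⟩ := F.exists_enum ht
      exact ⟨v, fun _ => hv⟩
    · exact ⟨fun _ => 0, fun h => absurd h ht⟩
  choose v hv using henum
  refine ⟨fun t => |e.det (Fin.cons F.center (v t) : Fin (d + 1) → V)|,
    fun t ht => abs_pos.2 (F.det_ne_zero ht e (hv t ht).2), fun t ht k hk => ?_⟩
  obtain ⟨hi, hr⟩ := hv t ht
  obtain ⟨a, ha⟩ : k ∈ Set.range (v t) := hr ▸ hk
  have hs := F.nb_mem ht hk
  have hl := F.opp_notMem ht hk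
  obtain ⟨hi', hr'⟩ := hv _ hs
  have hne : ∀ b, v t b ≠ F.opp t k := fun b h =>
    hl (Finset.mem_coe.1 (hr ▸ h ▸ Set.mem_range_self b))
  have hui : Function.Injective (Function.update (v t) a (F.opp t k)) :=
    fun b c h => by
      by_cases hb : b = a <;> by_cases hc : c = a
      · rw [hb, hc]
      · subst hb
        rw [Function.update_self, Function.update_of_ne hc] at h
        exact absurd h.symm (hne c)
      · subst hc
        rw [Function.update_self, Function.update_of_ne hb] at h
        exact absurd h (hne b)
      · rw [Function.update_of_ne hb, Function.update_of_ne hc] at h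
        exact hi h
  have hur : Set.range (Function.update (v t) a (F.opp t k)) = (F.nb t k : Set V) := by
    ext x
    rw [nb, Finset.coe_insert, Finset.coe_erase, ← hr, ← ha]
    constructor
    · rintro ⟨b, rfl⟩
      by_cases hb : b = a
      · subst hb
        simp
      · rw [Function.update_of_ne hb]
        exact Or.inr ⟨⟨b, rfl⟩, fun h => hb (hi h)⟩
    · rintro (rfl | ⟨⟨b, rfl⟩, hb⟩)
      · exact ⟨a, by simp⟩
      · exact ⟨b, Function.update_of_ne (fun h => hb (by rw [h]; rfl)) _ _⟩
  have := abs_det_eq_of_range_eq e (F.cons_injective hs hi' hr') (F.cons_injective hs hui hur)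
    (by rw [Fin.range_cons, Fin.range_cons, hr', hur])
  simp only [this]
  rw [F.det_update ht e hr, ha, abs_mul, abs_of_neg (F.coord_new_neg ht hk hl hs), neg_mul]

theorem exists_generic :
    ∃ g : V, ∀ t ∈ F.facets, ∀ k ∈ t, F.coord t k g ≠ 0 := by
  obtain ⟨g, -, hg⟩ := Module.Dual.exists_forall_mem_ne_zero_of_forall_exists
    (⊤ : Submodule ℝ V) (fun p : (Σ t : F.facets, (t : Finset V)) => F.coord p.1 p.2)
    fun p => ⟨p.2, trivial, by rw [F.coord_self _ p.1.2 _ p.2.2]; exact one_ne_zero⟩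
  exact ⟨g, fun t ht k hk => hg ⟨⟨t, ht⟩, ⟨k, hk⟩⟩⟩

theorem motion_eq_zero [FiniteDimensional ℝ V] (hV : finrank ℝ V = d + 1) {u : V → Dual ℝ V}
    (hu : F.IsMotion u) (hd : 3 ≤ d) {t₀ : Finset V} (ht₀ : t₀ ∈ F.facets)
    (h0 : ∀ i ∈ t₀, u i = 0) : ∀ t ∈ F.facets, ∀ i ∈ t, u i = 0 := by
  obtain ⟨vol, h1, h2⟩ := F.exists_vol hV
  obtain ⟨g, hg⟩ := F.exists_generic
  exact GenericFacetSystem.motion_eq_zero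
    { F with vol := vol, gen := g, vol_pos := h1, vol_nb := h2, gen_ne := hg } hu hd ht₀ h0

end FacetSystem

namespace FacetSystem

open scoped Classical

variable {V : Type*} [AddCommGroup V] [Module ℝ V] {d : ℕ} (F : FacetSystem V d)

/-- The vectors occurring in some facet. -/
noncomputable def vertices : Finset V := F.facets.biUnion id

/-- The pairs of vectors occurring together in some facet. -/
noncomputable def edges : Finset (Finset V) := F.facets.biUnion fun t => t.powersetCard 2

theorem mem_vertices {t : Finset V} (ht : t ∈ F.facets) {i : V} (hi : i ∈ t) : i ∈ F.vertices :=
  Finset.mem_biUnion.2 ⟨t, ht, hi⟩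

/-- Evaluation of the `i`-th functional at `j`. -/
noncomputable def evalAt (i j : V) : (F.vertices → Dual ℝ V) →ₗ[ℝ] ℝ :=
  LinearMap.applyₗ j ∘ₗ (if h : i ∈ F.vertices then LinearMap.proj ⟨i, h⟩ else 0)

theorem evalAt_apply (u : F.vertices → Dual ℝ V) (i j : V) :
    F.evalAt i j u = (if h : i ∈ F.vertices then u ⟨i, h⟩ else 0) j := by
  unfold evalAt
  split_ifs <;> simp

/-- The linear system defining infinitesimal motions, with a facet pinned down. -/
noncomputable def pinned (v : Fin d → V) : (F.vertices → Dual ℝ V) →ₗ[ℝ]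
    (F.vertices → ℝ) × (F.edges → ℝ) × ((Σ a : Fin d, Fin a) → ℝ) × (Fin d → ℝ) :=
  (LinearMap.pi fun x : F.vertices => F.evalAt x x).prod <|
    (LinearMap.pi fun e : F.edges => ∑ i ∈ (e : Finset V), ∑ j ∈ (e : Finset V), F.evalAt i j).prod <|
    (LinearMap.pi fun p : (Σ a : Fin d, Fin a) => F.evalAt (v p.1) (v (p.2.castLE p.1.2.le))).prod <|
    LinearMap.pi fun a => F.evalAt (v a) F.center

theorem pinned_injective [FiniteDimensional ℝ V] (hV : finrank ℝ V = d + 1) (hd : 3 ≤ d)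
    {t₀ : Finset V} (ht₀ : t₀ ∈ F.facets) {v : Fin d → V} (hv : Set.range v = t₀) :
    Function.Injective (F.pinned v) := by
  rw [injective_iff_map_eq_zero]
  intro u hu
  set w : V → Dual ℝ V := fun i => if h : i ∈ F.vertices then u ⟨i, h⟩ else 0 with hw
  have hB : ∀ i j, F.evalAt i j u = w i j := F.evalAt_apply u
  simp only [pinned, LinearMap.prod_apply, Function.prod_apply, Prod.mk_eq_zero] at hu
  obtain ⟨h1, h2, h3, h4⟩ := hu
  have h1' : ∀ x ∈ F.vertices, w x x = 0 := fun x hx => by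
    rw [← hB]
    exact congrFun h1 ⟨x, hx⟩
  have h2' : ∀ e ∈ F.edges, ∑ i ∈ e, ∑ j ∈ e, w i j = 0 := fun e he => by
    have := congrFun h2 ⟨e, he⟩
    simpa [hB] using this
  have hmot : F.IsMotion w := by
    intro t ht i hi j hj
    by_cases hij : i = j
    · subst hij
      rw [h1' i (F.mem_vertices ht hi), add_zero]
    · have := h2' {i, j} (Finset.mem_biUnion.2 ⟨t, ht, Finset.mem_powersetCard.2
        ⟨by simp [Finset.insert_subset_iff, hi, hj], Finset.card_pair hij⟩⟩)
      simp only [Finset.sum_pair hij, h1' i (F.mem_vertices ht hi),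
        h1' j (F.mem_vertices ht hj)] at this
      linarith
  have hmem : ∀ a, v a ∈ t₀ := fun a => Finset.mem_coe.1 (hv ▸ Set.mem_range_self a)
  have hlt : ∀ a b : Fin d, b < a → w (v a) (v b) = 0 := fun a b hab => by
    rw [← hB]
    exact congrFun h3 ⟨a, ⟨b, hab⟩⟩
  have hall : ∀ a b : Fin d, w (v a) (v b) = 0 := fun a b => by
    rcases lt_trichotomy a b with h | h | h
    · have := hmot t₀ ht₀ _ (hmem a) _ (hmem b)
      rwa [hlt b a h, add_zero] at this
    · rw [h, h1' _ (F.mem_vertices ht₀ (hmem b))]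
    · exact hlt a b h
  have h0 : ∀ i ∈ t₀, w i = 0 := by
    intro i hi
    obtain ⟨a, rfl⟩ : i ∈ Set.range v := hv ▸ hi
    refine LinearMap.ext fun x => ?_
    have hc : w (v a) F.center = 0 := by
      rw [← hB]
      exact congrFun h4 a
    rw [F.apply_eq ht₀, hc, mul_zero, add_zero]
    refine Finset.sum_eq_zero fun j hj => ?_
    obtain ⟨b, rfl⟩ : j ∈ Set.range v := hv ▸ hj
    rw [hall, mul_zero]
  funext ⟨x, hx⟩
  obtain ⟨t, ht, hxt⟩ := Finset.mem_biUnion.1 hx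
  have := F.motion_eq_zero hV hmot hd ht₀ h0 t ht x hxt
  rw [hw] at this
  simpa [hx] using this

/-- The lower bound for the number of edges of a facet system. -/
theorem lower_bound [FiniteDimensional ℝ V] (hV : finrank ℝ V = d + 1) (hd : 3 ≤ d)
    (hne : F.facets.Nonempty) :
    d * F.vertices.card ≤ F.edges.card + (d + 1).choose 2 := by
  obtain ⟨t₀, ht₀⟩ := hne
  obtain ⟨v, -, hv⟩ := F.exists_enum ht₀
  have h := LinearMap.finrank_le_finrank_of_injective (F.pinned_injective hV hd ht₀ hv)
  simp only [Module.finrank_prod, Module.finrank_fintype_fun_eq_card, Module.finrank_pi_fintype,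
    Subspace.dual_finrank_eq, hV, Fintype.card_coe, Finset.sum_const, Finset.card_univ,
    Fintype.card_sigma, Fintype.card_fin, smul_eq_mul] at h
  rw [Fin.sum_univ_eq_sum_range (fun i => i) d, Finset.sum_range_id, ← Nat.choose_two_right] at h
  rw [Nat.choose_succ_succ' d 1, Nat.choose_one_right]
  linarith

end FacetSystem

open scoped Classical in
/-- The elements of `X` at which `φ` vanishes. -/
noncomputable def zeros {V : Type*} [AddCommGroup V] [Module ℝ V] (X : Finset V)
    (φ : Dual ℝ V) : Finset V := X.filter fun x => φ x = 0

/-- The generators of a full-dimensional pointed cone all of whose proper faces are simplicial. -/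
structure IsSimplicialCone {V : Type*} [AddCommGroup V] [Module ℝ V] (X : Finset V) : Prop where
  span_eq : Submodule.span ℝ (X : Set V) = ⊤
  exists_pos : ∃ φ : Dual ℝ V, ∀ x ∈ X, 0 < φ x
  indep : ∀ φ : Dual ℝ V, φ ≠ 0 → (∀ x ∈ X, 0 ≤ φ x) → LinearIndepOn ℝ id (zeros X φ : Set V)

namespace IsSimplicialCone

open scoped Classical

variable {V : Type*} [AddCommGroup V] [Module ℝ V] {X : Finset V}

theorem mem_zeros {φ : Dual ℝ V} {x : V} : x ∈ zeros X φ ↔ x ∈ X ∧ φ x = 0 := Finset.mem_filter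

theorem exists_ne_zero (hX : IsSimplicialCone X) {φ : Dual ℝ V} (hφ : φ ≠ 0) :
    ∃ x ∈ X, φ x ≠ 0 := by
  by_contra! h
  exact hφ (LinearMap.ext_on hX.span_eq fun x hx => h x hx)

/-- Rotating a supporting hyperplane until it hits a further generator. -/
theorem exists_rotate (hX : IsSimplicialCone X) {φ ψ : Dual ℝ V} (hφ : φ ≠ 0)
    (h0 : ∀ x ∈ X, 0 ≤ φ x) (hψ : ∀ x ∈ X, φ x = 0 → 0 ≤ ψ x) :
    ∃ c : ℝ, (∀ x ∈ X, 0 ≤ (ψ + c • φ) x) ∧ ∃ l ∈ X, φ l ≠ 0 ∧ (ψ + c • φ) l = 0 := by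
  obtain ⟨x, hx, hx0⟩ := hX.exists_ne_zero hφ
  obtain ⟨l, hl, hmax⟩ := Finset.exists_max_image (X.filter fun x => φ x ≠ 0)
    (fun x => -ψ x / φ x) ⟨x, Finset.mem_filter.2 ⟨hx, hx0⟩⟩
  rw [Finset.mem_filter] at hl
  refine ⟨-ψ l / φ l, fun y hy => ?_, l, hl.1, hl.2, ?_⟩
  · by_cases hy0 : φ y = 0
    · simpa [hy0] using hψ y hy hy0
    · have hpos : 0 < φ y := lt_of_le_of_ne (h0 y hy) (Ne.symm hy0)
      have := (div_le_iff₀ hpos).1 (hmax y (Finset.mem_filter.2 ⟨hy, hy0⟩))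
      simp only [LinearMap.add_apply, LinearMap.smul_apply, smul_eq_mul]
      linarith
  · have := hl.2
    simp only [LinearMap.add_apply, LinearMap.smul_apply, smul_eq_mul]
    field_simp
    ring

variable {d : ℕ}

theorem exists_coords (hV : finrank ℝ V = d + 1) {t : Finset V} (hcard : t.card = d)
    (hind : LinearIndepOn ℝ id (t : Set V)) {o : V} {φ : Dual ℝ V} (hφ : ∀ x ∈ t, φ x = 0)
    (ho : φ o = 1) :
    ∃ c : V → Dual ℝ V, (∀ i ∈ t, c i i = 1) ∧ (∀ i ∈ t, ∀ j ∈ t, j ≠ i → c i j = 0) ∧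
      (∀ i ∈ t, c i o = 0) ∧ ∀ v, v = ∑ i ∈ t, c i v • i + φ v • o := by
  have hot : o ∉ t := fun h => by
    rw [hφ o h] at ho
    exact zero_ne_one ho
  have hspan : o ∉ Submodule.span ℝ (id '' (t : Set V)) := fun h => by
    have : Submodule.span ℝ (id '' (t : Set V)) ≤ LinearMap.ker φ := by
      rw [Set.image_id, Submodule.span_le]
      exact fun x hx => LinearMap.mem_ker.2 (hφ x hx)
    rw [LinearMap.mem_ker.1 (this h)] at ho
    exact zero_ne_one ho
  have hli : LinearIndependent ℝ (fun x : (insert o t : Finset V) => (x : V)) := by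
    have := hind.insert hspan
    rw [← Finset.coe_insert] at this
    exact this
  have hc : Fintype.card (insert o t : Finset V) = finrank ℝ V := by
    rw [Fintype.card_coe, Finset.card_insert_of_notMem hot, hcard, hV]
  have : Nonempty (insert o t : Finset V) := ⟨⟨o, Finset.mem_insert_self _ _⟩⟩
  let b := basisOfLinearIndependentOfCardEqFinrank hli hc
  have hb : ∀ x, b x = x := fun x => by
    rw [coe_basisOfLinearIndependentOfCardEqFinrank]
  have hcoord : ∀ (i : V) (hi : i ∈ insert o t) (j : V) (hj : j ∈ insert o t),
      b.coord ⟨i, hi⟩ j = if j = i then 1 else 0 := fun i hi j hj => by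
    have h : b.coord ⟨i, hi⟩ (b ⟨j, hj⟩) = if j = i then 1 else 0 := by
      rw [Basis.coord_apply, Basis.repr_self, Finsupp.single_apply]
      simp
    rwa [hb] at h
  have hmem : ∀ {i}, i ∈ t → i ∈ insert o t := fun h => Finset.mem_insert_of_mem h
  have hoo : o ∈ insert o t := Finset.mem_insert_self _ _
  have hφb : φ = b.coord ⟨o, hoo⟩ := b.ext fun ⟨x, hx⟩ => by
    rw [hb, hcoord o hoo x hx]
    split_ifs with h
    · simp only [h, ho]
    · exact hφ x ((Finset.mem_insert.1 hx).resolve_left h)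
  refine ⟨fun i => if h : i ∈ insert o t then b.coord ⟨i, h⟩ else 0, fun i hi => ?_,
    fun i hi j hj hji => ?_, fun i hi => ?_, fun v => ?_⟩
  · simp only [dif_pos (hmem hi)]
    rw [hcoord _ _ _ (hmem hi), if_pos rfl]
  · simp only [dif_pos (hmem hi)]
    rw [hcoord _ _ _ (hmem hj), if_neg hji]
  · simp only [dif_pos (hmem hi)]
    rw [hcoord _ _ _ hoo, if_neg fun h : o = i => hot (h ▸ hi)]
  · have h1 : ∑ i, b.repr v i • b i = ∑ i : (insert o t : Finset V),
        (if h : (i : V) ∈ insert o t then b.coord ⟨i, h⟩ else 0) v • (i : V) :=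
      Finset.sum_congr rfl fun i _ => by rw [dif_pos i.2, hb, Basis.coord_apply]
    rw [b.sum_repr, Finset.sum_coe_sort (insert o t)
      (fun i => (if h : i ∈ insert o t then b.coord ⟨i, h⟩ else 0) v • i),
      Finset.sum_insert hot, dif_pos hoo, ← hφb, add_comm] at h1
    exact h1

variable [FiniteDimensional ℝ V]

theorem card_zeros_le (hX : IsSimplicialCone X) (hV : finrank ℝ V = d + 1) {φ : Dual ℝ V}
    (hφ : φ ≠ 0) (h0 : ∀ x ∈ X, 0 ≤ φ x) : (zeros X φ).card ≤ d := by
  have h1 := finrank_span_finset_eq_card (hX.indep φ hφ h0)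
  have hne : Submodule.span ℝ (zeros X φ : Set V) ≠ ⊤ := fun h =>
    hφ (LinearMap.ext_on h fun x hx => (mem_zeros.1 hx).2)
  have := Submodule.finrank_lt hne
  omega

theorem exists_facet (hX : IsSimplicialCone X) (hV : finrank ℝ V = d + 1) (n : ℕ) {φ : Dual ℝ V}
    (hφ : φ ≠ 0) (h0 : ∀ x ∈ X, 0 ≤ φ x) (hn : d ≤ (zeros X φ).card + n) :
    ∃ φ' : Dual ℝ V, φ' ≠ 0 ∧ (∀ x ∈ X, 0 ≤ φ' x) ∧ (zeros X φ').card = d ∧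
      zeros X φ ⊆ zeros X φ' := by
  induction n generalizing φ with
  | zero => exact ⟨φ, hφ, h0, le_antisymm (hX.card_zeros_le hV hφ h0) (by omega), subset_rfl⟩
  | succ n ih =>
    by_cases hd : d ≤ (zeros X φ).card
    · exact ⟨φ, hφ, h0, le_antisymm (hX.card_zeros_le hV hφ h0) hd, subset_rfl⟩
    obtain ⟨j, hj, hj0⟩ := hX.exists_ne_zero hφ
    have hlt : Submodule.span ℝ ((insert j (zeros X φ) : Finset V) : Set V) < ⊤ := by
      refine lt_top_iff_ne_top.2 fun h => ?_
      have h1 := finrank_span_finset_le_card (R := ℝ) (insert j (zeros X φ))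
      have h2 := Finset.card_insert_le j (zeros X φ)
      rw [Set.finrank, h, finrank_top] at h1
      omega
    obtain ⟨ψ, hψ, hle⟩ := Submodule.exists_le_ker_of_lt_top _ hlt
    have hψ0 : ∀ x ∈ insert j (zeros X φ), ψ x = 0 := fun x hx =>
      LinearMap.mem_ker.1 (hle (Submodule.subset_span hx))
    have hz : ∀ x ∈ X, φ x = 0 → ψ x = 0 := fun x hx h =>
      hψ0 x (Finset.mem_insert_of_mem (mem_zeros.2 ⟨hx, h⟩))
    obtain ⟨c, h1, l, hl, hl0, hl1⟩ := hX.exists_rotate hφ h0 fun x hx h => (hz x hx h).ge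
    have hne : ψ + c • φ ≠ 0 := fun h => by
      have hc := LinearMap.congr_fun h j
      simp only [LinearMap.add_apply, LinearMap.smul_apply, smul_eq_mul, LinearMap.zero_apply,
        hψ0 j (Finset.mem_insert_self _ _), zero_add, mul_eq_zero, hj0, or_false] at hc
      rw [hc, zero_smul, add_zero] at h
      exact hψ h
    have hsub : insert l (zeros X φ) ⊆ zeros X (ψ + c • φ) := by
      intro x hx
      rcases Finset.mem_insert.1 hx with rfl | hx
      · exact mem_zeros.2 ⟨hl, hl1⟩
      · obtain ⟨hxX, hx0⟩ := mem_zeros.1 hx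
        exact mem_zeros.2 ⟨hxX, by simp [hz x hxX hx0, hx0]⟩
    have hcard := Finset.card_le_card hsub
    rw [Finset.card_insert_of_notMem fun h => hl0 (mem_zeros.1 h).2] at hcard
    obtain ⟨φ', h2, h3, h4, h5⟩ := ih hne h1 (by omega)
    exact ⟨φ', h2, h3, h4, (Finset.subset_insert _ _).trans (hsub.trans h5)⟩

theorem exists_pivot (hX : IsSimplicialCone X) (hV : finrank ℝ V = d + 1) {φ : Dual ℝ V}
    (hφ : φ ≠ 0) (h0 : ∀ x ∈ X, 0 ≤ φ x) (hcard : (zeros X φ).card = d) {k : V}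
    (hk : k ∈ zeros X φ) {ψ : Dual ℝ V} (hψk : ψ k = 1)
    (hψ : ∀ j ∈ zeros X φ, j ≠ k → ψ j = 0) :
    ∃ φ' : Dual ℝ V, φ' ≠ 0 ∧ (∀ x ∈ X, 0 ≤ φ' x) ∧
      ∃ l ∉ zeros X φ, zeros X φ' = insert l ((zeros X φ).erase k) := by
  obtain ⟨c, h1, l, hl, hl0, hl1⟩ := hX.exists_rotate (ψ := ψ) hφ h0 fun x hx h => by
    by_cases hxk : x = k
    · rw [hxk, hψk]
      exact zero_le_one
    · exact (hψ x (mem_zeros.2 ⟨hx, h⟩) hxk).ge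
  have hne : ψ + c • φ ≠ 0 := fun h => by
    have hc := LinearMap.congr_fun h k
    simp [hψk, (mem_zeros.1 hk).2] at hc
  have hlZ : l ∉ zeros X φ := fun h => hl0 (mem_zeros.1 h).2
  refine ⟨_, hne, h1, l, hlZ, (Finset.eq_of_subset_of_card_le ?_ ?_).symm⟩
  · intro x hx
    rcases Finset.mem_insert.1 hx with rfl | hx
    · exact mem_zeros.2 ⟨hl, hl1⟩
    · obtain ⟨hxk, hx⟩ := Finset.mem_erase.1 hx
      exact mem_zeros.2 ⟨(mem_zeros.1 hx).1, by simp [hψ x hx hxk, (mem_zeros.1 hx).2]⟩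
  · rw [Finset.card_insert_of_notMem fun h => hlZ (Finset.mem_of_mem_erase h),
      Finset.card_erase_add_one hk, hcard]
    exact hX.card_zeros_le hV hne h1

/-- The facets of a simplicial cone form a facet system. -/
theorem exists_facetSystem (hX : IsSimplicialCone X) (hV : finrank ℝ V = d + 1) :
    ∃ F : FacetSystem V d, F.facets.Nonempty ∧
      (∀ t ∈ F.facets, t ⊆ X ∧ ∀ x ∈ X, 0 ≤ F.supp t x ∧ (F.supp t x = 0 ↔ x ∈ t)) ∧
      ∀ φ : Dual ℝ V, φ ≠ 0 → (∀ x ∈ X, 0 ≤ φ x) → ∃ t ∈ F.facets, zeros X φ ⊆ t := by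
  set facets : Finset (Finset V) := X.powerset.filter fun t =>
    t.card = d ∧ ∃ φ : Dual ℝ V, φ ≠ 0 ∧ (∀ x ∈ X, 0 ≤ φ x) ∧ zeros X φ = t with hfacets
  have hmem : ∀ t, t ∈ facets ↔
      t.card = d ∧ ∃ φ : Dual ℝ V, φ ≠ 0 ∧ (∀ x ∈ X, 0 ≤ φ x) ∧ zeros X φ = t := fun t => by
    rw [hfacets, Finset.mem_filter, and_iff_right_iff_imp]
    rintro ⟨-, φ, -, -, rfl⟩
    exact Finset.mem_powerset.2 (Finset.filter_subset _ _)
  set o : V := ∑ x ∈ X, x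
  have hnorm : ∀ t ∈ facets, ∃ φ : Dual ℝ V, φ o = 1 ∧ (∀ x ∈ X, 0 ≤ φ x) ∧ zeros X φ = t := by
    intro t ht
    obtain ⟨-, φ, hφ, h0, hz⟩ := (hmem t).1 ht
    obtain ⟨x, hx, hx0⟩ := hX.exists_ne_zero hφ
    have hpos : 0 < φ o := by
      rw [map_sum]
      exact Finset.sum_pos' h0 ⟨x, hx, lt_of_le_of_ne (h0 x hx) (Ne.symm hx0)⟩
    refine ⟨(φ o)⁻¹ • φ, by simp [hpos.ne'], fun x hx => ?_, ?_⟩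
    · exact mul_nonneg (inv_nonneg.2 hpos.le) (h0 x hx)
    · rw [← hz]
      ext x
      simp [mem_zeros, hpos.ne']
  have hcoords : ∀ t, ∃ (φ : Dual ℝ V) (c : V → Dual ℝ V), t ∈ facets →
      φ o = 1 ∧ (∀ x ∈ X, 0 ≤ φ x) ∧ zeros X φ = t ∧
      (∀ i ∈ t, c i i = 1) ∧ (∀ i ∈ t, ∀ j ∈ t, j ≠ i → c i j = 0) ∧
      (∀ i ∈ t, c i o = 0) ∧ ∀ v, v = ∑ i ∈ t, c i v • i + φ v • o := fun t => by
    by_cases ht : t ∈ facets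
    · obtain ⟨φ, h1, h2, h3⟩ := hnorm t ht
      have hφ : φ ≠ 0 := fun h => by simp [h] at h1
      obtain ⟨c, hc⟩ := exists_coords hV ((hmem t).1 ht).1 (h3 ▸ hX.indep φ hφ h2)
        (fun x hx => (mem_zeros.1 (h3.symm ▸ hx)).2) h1
      exact ⟨φ, c, fun _ => ⟨h1, h2, h3, hc⟩⟩
    · exact ⟨0, 0, fun h => absurd h ht⟩
  choose φ c hc using hcoords
  have hzero : ∀ t ∈ facets, ∀ x, x ∈ t ↔ x ∈ X ∧ φ t x = 0 := fun t ht x => by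
    conv_lhs => rw [← (hc t ht).2.2.1]
    exact mem_zeros
  have hne : ∀ t ∈ facets, φ t ≠ 0 := fun t ht h => by
    have := (hc t ht).1
    simp [h] at this
  have hfacet : ∀ ψ : Dual ℝ V, ψ ≠ 0 → (∀ x ∈ X, 0 ≤ ψ x) → ∃ t ∈ facets, zeros X ψ ⊆ t := by
    intro ψ hψ h0
    obtain ⟨ψ', h1, h2, h3, h4⟩ := hX.exists_facet hV d hψ h0 (Nat.le_add_left _ _)
    exact ⟨_, (hmem _).2 ⟨h3, ψ', h1, h2, rfl⟩, h4⟩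
  let F : FacetSystem V d :=
    { facets := facets
      center := o
      supp := φ
      coord := c
      card_eq := fun t ht => ((hmem t).1 ht).1
      supp_self := fun t ht i hi => ((hzero t ht i).1 hi).2
      supp_pos := fun t ht s hs i hi hit =>
        have hiX := ((hzero s hs i).1 hi).1
        lt_of_le_of_ne ((hc t ht).2.1 i hiX) fun h => hit ((hzero t ht i).2 ⟨hiX, h.symm⟩)
      supp_center := fun t ht => (hc t ht).1
      coord_self := fun t ht => (hc t ht).2.2.2.1
      coord_ne := fun t ht => (hc t ht).2.2.2.2.1
      coord_center := fun t ht => (hc t ht).2.2.2.2.2.1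
      expand := fun t ht => (hc t ht).2.2.2.2.2.2
      pivot := fun t ht k hk => by
        have hz := (hc t ht).2.2.1
        obtain ⟨φ', h1, h2, l, hl, h3⟩ := hX.exists_pivot hV (hne t ht) (hc t ht).2.1
          (by rw [hz]; exact ((hmem t).1 ht).1) (k := k) (ψ := c t k) (by rwa [hz])
          ((hc t ht).2.2.2.1 k hk) (by rw [hz]; exact (hc t ht).2.2.2.2.1 k hk)
        rw [hz] at hl h3
        refine ⟨l, hl, (hmem _).2 ⟨?_, φ', h1, h2, h3⟩⟩
        rw [Finset.card_insert_of_notMem fun h => hl (Finset.mem_of_mem_erase h),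
          Finset.card_erase_add_one hk]
        exact ((hmem t).1 ht).1 }
  have hfne : facets.Nonempty := by
    obtain ⟨lam, hlam⟩ := hX.exists_pos
    have : lam ≠ 0 := fun h => by
      have hemp : X = ∅ := Finset.eq_empty_of_forall_notMem fun x hx => by
        have := hlam x hx
        simp [h] at this
      have htop := hX.span_eq
      rw [hemp, Finset.coe_empty, Submodule.span_empty] at htop
      have := finrank_top ℝ V
      rw [← htop, finrank_bot] at this
      omega
    obtain ⟨t, ht, -⟩ := hfacet lam this fun x hx => (hlam x hx).le
    exact ⟨t, ht⟩
  refine ⟨F, hfne, fun t ht => ⟨fun x hx => ((hzero t ht x).1 hx).1, fun x hx =>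
    ⟨(hc t ht).2.1 x hx, fun h => (hzero t ht x).2 ⟨hx, h⟩, fun h => ((hzero t ht x).1 h).2⟩⟩,
    hfacet⟩

/-- The lower bound for the number of two-dimensional faces of a simplicial cone. -/
theorem lower_bound (hX : IsSimplicialCone X) (hV : finrank ℝ V = d + 1) (hd : 3 ≤ d) :
    ∃ (A : Finset V) (E : Finset (Finset V)), d * A.card ≤ E.card + (d + 1).choose 2 ∧
      (∀ (φ : Dual ℝ V) (x : V), φ ≠ 0 → (∀ x ∈ X, 0 ≤ φ x) → x ∈ zeros X φ → x ∈ A) ∧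
      ∀ e ∈ E, e.card = 2 ∧ ∃ φ : Dual ℝ V, φ ≠ 0 ∧ (∀ x ∈ X, 0 ≤ φ x) ∧ zeros X φ = e := by
  obtain ⟨F, hne, hF, hex⟩ := hX.exists_facetSystem hV
  refine ⟨F.vertices, F.edges, F.lower_bound hV hd hne, fun φ x hφ h0 hx => ?_, fun e he => ?_⟩
  · obtain ⟨t, ht, hsub⟩ := hex φ hφ h0
    exact F.mem_vertices ht (hsub hx)
  obtain ⟨t, ht, het⟩ := Finset.mem_biUnion.1 he
  obtain ⟨hsub, hcard⟩ := Finset.mem_powersetCard.1 het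
  have hnb : ∀ k ∈ t \ e, F.nb t k ∈ F.facets := fun k hk =>
    F.nb_mem ht (Finset.mem_sdiff.1 hk).1
  have hpos : ∀ x ∈ X, ∀ k ∈ t \ e, 0 ≤ F.supp (F.nb t k) x := fun x hx k hk =>
    ((hF _ (hnb k hk)).2 x hx).1
  refine ⟨hcard, F.supp t + ∑ k ∈ t \ e, F.supp (F.nb t k), fun h => ?_, fun x hx => ?_, ?_⟩
  · have hc := LinearMap.congr_fun h F.center
    rw [LinearMap.add_apply, LinearMap.sum_apply, F.supp_center t ht, LinearMap.zero_apply,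
      Finset.sum_congr rfl fun k hk => F.supp_center _ (hnb k hk), Finset.sum_const,
      nsmul_eq_mul, mul_one] at hc
    have : (0 : ℝ) ≤ (t \ e).card := Nat.cast_nonneg _
    linarith
  · rw [LinearMap.add_apply, LinearMap.sum_apply]
    exact add_nonneg ((hF t ht).2 x hx).1 (Finset.sum_nonneg (hpos x hx))
  · ext x
    rw [mem_zeros, LinearMap.add_apply, LinearMap.sum_apply]
    constructor
    · rintro ⟨hx, h⟩
      rw [add_eq_zero_iff_of_nonneg ((hF t ht).2 x hx).1 (Finset.sum_nonneg (hpos x hx)),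
        Finset.sum_eq_zero_iff_of_nonneg (hpos x hx)] at h
      have hxt : x ∈ t := ((hF t ht).2 x hx).2.1 h.1
      by_contra hxe
      have hk := Finset.mem_sdiff.2 ⟨hxt, hxe⟩
      exact F.notMem_nb ht hxt (((hF _ (hnb x hk)).2 x hx).2.1 (h.2 x hk))
    · intro hx
      have hxt := hsub hx
      refine ⟨(hF t ht).1 hxt, ?_⟩
      rw [F.supp_self t ht x hxt, zero_add]
      refine Finset.sum_eq_zero fun k hk => F.supp_self _ (hnb k hk) x ?_
      exact Finset.mem_insert_of_mem (Finset.mem_erase.2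
        ⟨fun h => (Finset.mem_sdiff.1 hk).2 (h ▸ hx), hxt⟩)

end IsSimplicialCone

section Homogenization

variable {E : Type*} [NormedAddCommGroup E] [NormedSpace ℝ E]

/-- The embedding of `E` in `E × ℝ` at height one. -/
noncomputable def homogenize (E : Type*) [NormedAddCommGroup E] [NormedSpace ℝ E] :
    E →ᵃ[ℝ] E × ℝ :=
  (AffineMap.id ℝ E).prod (AffineMap.const ℝ E (1 : ℝ))

theorem homogenize_apply (v : E) : homogenize E v = (v, 1) := rfl

theorem homogenize_injective : Function.Injective (homogenize E) := fun _ _ h =>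
  (Prod.ext_iff.1 h).1

/-- The finite set `X` placed at height one. -/
noncomputable def liftFinset (X : Finset E) : Finset (E × ℝ) :=
  X.map ⟨homogenize E, homogenize_injective⟩

theorem mem_liftFinset {X : Finset E} {v : E} : homogenize E v ∈ liftFinset X ↔ v ∈ X :=
  Finset.mem_map' _

theorem coe_liftFinset (X : Finset E) : (liftFinset X : Set (E × ℝ)) = homogenize E '' X :=
  Finset.coe_map _ _

/-- The part of `P` on which the functional `φ` on the homogenization vanishes. -/
def faceOf (P : Set E) (φ : Dual ℝ (E × ℝ)) : Set E := {v ∈ P | φ (homogenize E v) = 0}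

theorem span_homogenize {s : Set E} (hs : affineSpan ℝ s = ⊤) :
    Submodule.span ℝ (homogenize E '' s) = ⊤ := by
  set S := Submodule.span ℝ (homogenize E '' s)
  have h1 : ∀ v, homogenize E v ∈ S := by
    have : affineSpan ℝ s ≤ S.toAffineSubspace.comap (homogenize E) :=
      affineSpan_le.2 fun v hv => Submodule.subset_span (Set.mem_image_of_mem _ hv)
    rw [hs] at this
    exact fun v => this (AffineSubspace.mem_top ℝ E v)
  refine top_le_iff.1 fun x _ => ?_
  have : x = (homogenize E x.1 - homogenize E 0) + x.2 • homogenize E 0 := by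
    ext <;> simp [homogenize_apply]
  rw [this]
  exact add_mem (sub_mem (h1 _) (h1 _)) (S.smul_mem _ (h1 _))

theorem linearIndependent_homogenize {ι : Type*} {p : ι → E} (hp : AffineIndependent ℝ p) :
    LinearIndependent ℝ fun i => homogenize E (p i) := by
  rw [linearIndependent_iff']
  intro s g hg i hi
  rw [Prod.ext_iff, Prod.fst_sum, Prod.snd_sum] at hg
  refine affineIndependent_iff.1 hp s g ?_ ?_ i hi
  · simpa [homogenize_apply] using hg.2
  · simpa [homogenize_apply] using hg.1

theorem nonneg_on_convexHull {s : Set E} {φ : Dual ℝ (E × ℝ)}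
    (h : ∀ v ∈ s, 0 ≤ φ (homogenize E v)) {v : E} (hv : v ∈ convexHull ℝ s) :
    0 ≤ φ (homogenize E v) :=
  convexHull_min (t := (φ.toAffineMap.comp (homogenize E)) ⁻¹' Set.Ici 0) h
    ((convex_Ici (0 : ℝ)).affine_preimage _) hv

theorem isExposed_faceOf [FiniteDimensional ℝ E] {P : Set E} {φ : Dual ℝ (E × ℝ)}
    (h : ∀ v ∈ P, 0 ≤ φ (homogenize E v)) : IsExposed ℝ P (faceOf P φ) := by
  rintro ⟨w, hw, hw0⟩
  have hsplit : ∀ v, φ (homogenize E v) = φ (v, 0) + φ (0, 1) := fun v => by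
    rw [← map_add, homogenize_apply]
    simp
  refine ⟨-LinearMap.toContinuousLinearMap (φ ∘ₗ LinearMap.inl ℝ E ℝ), ?_⟩
  ext v
  simp only [faceOf, Set.mem_ofPred_eq, neg_apply,
    LinearMap.coe_toContinuousLinearMap', LinearMap.comp_apply, LinearMap.inl_apply,
    neg_le_neg_iff]
  refine and_congr_right fun hv => ⟨fun hv0 y hy => ?_, fun hmin => ?_⟩
  · have := h y hy
    rw [hsplit] at this hv0
    linarith
  · have h1 := hmin w hw
    have h2 := h v hv
    rw [hsplit] at h2 hw0 ⊢
    linarith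

theorem exists_eq_faceOf {P F : Set E} (hF : IsProperFace P F) :
    ∃ φ : Dual ℝ (E × ℝ), φ ≠ 0 ∧ (∀ v ∈ P, 0 ≤ φ (homogenize E v)) ∧ F = faceOf P φ := by
  obtain ⟨hne, hproper, hexp⟩ := hF
  obtain ⟨l, hl⟩ := hexp hne
  obtain ⟨w, hw⟩ := hne
  have hw' := hw
  rw [hl] at hw'
  have hφ : ∀ v, ((l w) • LinearMap.snd ℝ E ℝ - (l : E →ₗ[ℝ] ℝ) ∘ₗ LinearMap.fst ℝ E ℝ)
      (homogenize E v) = l w - l v := fun v => by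
    simp [homogenize_apply]
  have hface : F = faceOf P
      ((l w) • LinearMap.snd ℝ E ℝ - (l : E →ₗ[ℝ] ℝ) ∘ₗ LinearMap.fst ℝ E ℝ) := by
    conv_lhs => rw [hl]
    ext v
    simp only [faceOf, Set.mem_ofPred_eq, hφ, sub_eq_zero]
    refine and_congr_right fun hv => ⟨fun h => ?_, fun h y hy => ?_⟩
    · exact le_antisymm (h w hw'.1) (hw'.2 v hv)
    · rw [← h]
      exact hw'.2 y hy
  refine ⟨_, fun h => hproper ?_, fun v hv => ?_, hface⟩
  · rw [hface, h]
    ext v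
    simp [faceOf]
  · rw [hφ]
    exact sub_nonneg.2 (hw'.2 v hv)

end Homogenization

section Polytope

open scoped Classical

variable {E : Type*} [NormedAddCommGroup E] [NormedSpace ℝ E]
  {P : Set E} {X : Finset E}

theorem convexHull_extremePoints_eq {s : Set E} (hs : IsCompact s) (hc : Convex ℝ s)
    (hfin : (s.extremePoints ℝ).Finite) : convexHull ℝ (s.extremePoints ℝ) = s := by
  conv_rhs => rw [← closure_convexHull_extremePoints hs hc]
  exact (hfin.isCompact_convexHull ℝ).isClosed.closure_eq.symm

theorem IsPolytope.exists_finset (hP : IsPolytope P) :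
    ∃ X : Finset E, (X : Set E) = P.extremePoints ℝ ∧ P = convexHull ℝ (X : Set E) := by
  obtain ⟨V, rfl⟩ := hP
  have hfin : ((convexHull ℝ (V : Set E)).extremePoints ℝ).Finite :=
    V.finite_toSet.subset extremePoints_convexHull_subset
  refine ⟨hfin.toFinset, hfin.coe_toFinset, ?_⟩
  rw [hfin.coe_toFinset, convexHull_extremePoints_eq (V.finite_toSet.isCompact_convexHull ℝ)
    (convex_convexHull ℝ _) hfin]

theorem extremePoints_face (hX : (X : Set E) = P.extremePoints ℝ) {F : Set E}
    (hF : IsExposed ℝ P F) : F.extremePoints ℝ = ((X.filter (· ∈ F) : Finset E) : Set E) := by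
  rw [hF.isExtreme.extremePoints_eq, ← hX, Finset.coe_filter]
  ext v
  exact and_comm

theorem eq_convexHull_face (hX : (X : Set E) = P.extremePoints ℝ)
    (hP : P = convexHull ℝ (X : Set E)) {F : Set E} (hF : IsExposed ℝ P F) :
    F = convexHull ℝ ((X.filter (· ∈ F) : Finset E) : Set E) := by
  have hcomp : IsCompact P := hP ▸ X.finite_toSet.isCompact_convexHull ℝ
  have hconv : Convex ℝ P := hP ▸ convex_convexHull ℝ _
  rw [← extremePoints_face hX hF]
  refine (convexHull_extremePoints_eq (hF.isCompact hcomp) (hF.convex hconv) ?_).symm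
  rw [extremePoints_face hX hF]
  exact Finset.finite_toSet _

theorem finite_properFaces (hX : (X : Set E) = P.extremePoints ℝ)
    (hP : P = convexHull ℝ (X : Set E)) : {F | IsProperFace P F}.Finite := by
  refine (X.powerset.finite_toSet.image fun s : Finset E => convexHull ℝ (s : Set E)).subset ?_
  intro F hF
  exact ⟨X.filter (· ∈ F), Finset.mem_powerset.2 (Finset.filter_subset _ _),
    (eq_convexHull_face hX hP hF.2.2).symm⟩

theorem mem_zeros_liftFinset {φ : Dual ℝ (E × ℝ)} {v : E} (hX : (X : Set E) ⊆ P) :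
    homogenize E v ∈ zeros (liftFinset X) φ ↔ v ∈ X.filter (· ∈ faceOf P φ) := by
  rw [IsSimplicialCone.mem_zeros, Finset.mem_filter,
    mem_liftFinset]
  exact and_congr_right fun hv => ⟨fun h => ⟨hX hv, h⟩, fun h => h.2⟩

theorem zeros_liftFinset {φ : Dual ℝ (E × ℝ)} (hX : (X : Set E) ⊆ P) :
    zeros (liftFinset X) φ = liftFinset (X.filter (· ∈ faceOf P φ)) := by
  ext y
  constructor
  · intro hy
    obtain ⟨v, -, rfl⟩ := Finset.mem_map.1 (IsSimplicialCone.mem_zeros.1 hy).1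
    exact Finset.mem_map_of_mem _ ((mem_zeros_liftFinset hX).1 hy)
  · intro hy
    obtain ⟨v, hv, rfl⟩ := Finset.mem_map.1 hy
    exact (mem_zeros_liftFinset hX).2 hv

variable [FiniteDimensional ℝ E]

theorem isProperFace_faceOf (hP : P = convexHull ℝ (X : Set E)) (hfull : affineSpan ℝ P = ⊤)
    {φ : Dual ℝ (E × ℝ)} (hφ : φ ≠ 0) (h0 : ∀ x ∈ liftFinset X, 0 ≤ φ x)
    (hne : (zeros (liftFinset X) φ).Nonempty) : IsProperFace P (faceOf P φ) := by
  have hXP : (X : Set E) ⊆ P := hP ▸ subset_convexHull ℝ _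
  refine ⟨?_, fun h => hφ ?_, isExposed_faceOf fun v hv => nonneg_on_convexHull
    (fun w hw => h0 _ (mem_liftFinset.2 hw)) (hP ▸ hv)⟩
  · rw [zeros_liftFinset hXP] at hne
    obtain ⟨v, hv⟩ := Finset.map_nonempty.1 hne
    exact ⟨v, (Finset.mem_filter.1 hv).2⟩
  · refine LinearMap.ext_on (span_homogenize hfull) ?_
    rintro _ ⟨v, hv, rfl⟩
    rw [← h] at hv
    exact hv.2

theorem isSimplicialCone_liftFinset (hX : (X : Set E) = P.extremePoints ℝ)
    (hP : P = convexHull ℝ (X : Set E)) (hfull : affineSpan ℝ P = ⊤)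
    (hsimp : ∀ F : Set E, IsProperFace P F →
      AffineIndependent ℝ (fun x : F.extremePoints ℝ => (x : E))) :
    IsSimplicialCone (liftFinset X) where
  span_eq := by
    rw [coe_liftFinset]
    refine span_homogenize ?_
    rw [← affineSpan_convexHull, ← hP, hfull]
  exists_pos := ⟨LinearMap.snd ℝ E ℝ, fun x hx => by
    obtain ⟨v, -, rfl⟩ := Finset.mem_map.1 hx
    exact one_pos⟩
  indep := fun φ hφ h0 => by
    have hXP : (X : Set E) ⊆ P := hP ▸ subset_convexHull ℝ _
    rcases (zeros (liftFinset X) φ).eq_empty_or_nonempty with he | hne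
    · rw [he, Finset.coe_empty]
      exact linearIndepOn_empty ℝ id
    have hF := isProperFace_faceOf hP hfull hφ h0 hne
    have := (linearIndependent_homogenize (hsimp _ hF)).linearIndepOn_id
    rwa [← Set.image_eq_range, extremePoints_face hX hF.2.2, ← coe_liftFinset,
      ← zeros_liftFinset hXP] at this

end Polytope

theorem finrank_direction_segment {E : Type*} [AddCommGroup E] [Module ℝ E] {a b : E}
    (hab : a ≠ b) : Module.finrank ℝ (affineSpan ℝ (convexHull ℝ {a, b})).direction = 1 := by
  rw [affineSpan_convexHull, direction_affineSpan, vectorSpan_pair]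
  exact finrank_span_singleton (sub_ne_zero.2 hab)

section FaceCount

open scoped Classical

variable {d : ℕ} {P : Set (Fin d → ℝ)} {X : Finset (Fin d → ℝ)}

theorem faceCount_zero_le (hX : (X : Set (Fin d → ℝ)) = P.extremePoints ℝ)
    (hP : P = convexHull ℝ (X : Set (Fin d → ℝ))) {A : Finset ((Fin d → ℝ) × ℝ)}
    (hA : ∀ (φ : Dual ℝ ((Fin d → ℝ) × ℝ)) (x : (Fin d → ℝ) × ℝ), φ ≠ 0 →
      (∀ x ∈ liftFinset X, 0 ≤ φ x) →
      x ∈ zeros (liftFinset X) φ → x ∈ A) :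
    faceCount P 0 ≤ A.card := by
  have hsub : {F : Set (Fin d → ℝ) | IsProperFace P F ∧
      Module.finrank ℝ (affineSpan ℝ F).direction = 0} ⊆
      (fun x : (Fin d → ℝ) × ℝ => ({x.1} : Set (Fin d → ℝ))) '' A := by
    rintro F ⟨hF, hdim⟩
    have hXP : (X : Set (Fin d → ℝ)) ⊆ P := hX ▸ extremePoints_subset
    rw [Submodule.finrank_eq_zero, direction_affineSpan, vectorSpan_eq_bot_iff_subsingleton]
      at hdim
    have hvne : (X.filter (· ∈ F)).Nonempty := by
      rw [Finset.nonempty_iff_ne_empty]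
      intro h
      have := eq_convexHull_face hX hP hF.2.2
      rw [h, Finset.coe_empty, convexHull_empty] at this
      exact hF.1.ne_empty this
    obtain ⟨v, hv⟩ := hvne
    have hFv : F = {v} := hdim.eq_singleton_of_mem (Finset.mem_filter.1 hv).2
    obtain ⟨φ, hφ, h0, hFφ⟩ := exists_eq_faceOf hF
    refine ⟨homogenize _ v, hA φ _ hφ (fun x hx => ?_) ?_, hFv.symm⟩
    · obtain ⟨w, hw, rfl⟩ := Finset.mem_map.1 hx
      exact h0 w (hXP hw)
    · rw [mem_zeros_liftFinset hXP, ← hFφ]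
      exact hv
  calc faceCount P 0 ≤ ((fun x : (Fin d → ℝ) × ℝ => ({x.1} : Set (Fin d → ℝ))) '' A).ncard :=
        Set.ncard_le_ncard hsub (A.finite_toSet.image _)
    _ ≤ (A : Set ((Fin d → ℝ) × ℝ)).ncard := Set.ncard_image_le A.finite_toSet
    _ = A.card := Set.ncard_coe_finset A

theorem le_faceCount_one (hX : (X : Set (Fin d → ℝ)) = P.extremePoints ℝ)
    (hP : P = convexHull ℝ (X : Set (Fin d → ℝ))) (hfull : affineSpan ℝ P = ⊤)
    {A : Finset (Finset ((Fin d → ℝ) × ℝ))}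
    (hA : ∀ e ∈ A, e.card = 2 ∧ ∃ φ : Dual ℝ ((Fin d → ℝ) × ℝ), φ ≠ 0 ∧
      (∀ x ∈ liftFinset X, 0 ≤ φ x) ∧
      zeros (liftFinset X) φ = e) :
    A.card ≤ faceCount P 1 := by
  have hXP : (X : Set (Fin d → ℝ)) ⊆ P := hX ▸ extremePoints_subset
  set S := {F : Set (Fin d → ℝ) | IsProperFace P F ∧
    Module.finrank ℝ (affineSpan ℝ F).direction = 1} with hS
  have hfin : S.Finite := (finite_properFaces hX hP).subset fun F hF => hF.1
  have hsub : (A : Set (Finset ((Fin d → ℝ) × ℝ))) ⊆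
      (fun F : Set (Fin d → ℝ) => liftFinset (X.filter (· ∈ F))) '' S := by
    intro e he
    obtain ⟨hcard, φ, hφ, h0, hz⟩ := hA e he
    have hF := isProperFace_faceOf hP hfull hφ h0
      (by rw [hz, ← Finset.card_pos, hcard]; exact two_pos)
    rw [zeros_liftFinset hXP] at hz
    refine ⟨faceOf P φ, ⟨hF, ?_⟩, hz⟩
    rw [← hz, liftFinset, Finset.card_map, Finset.card_eq_two] at hcard
    obtain ⟨a, b, hab, h⟩ := hcard
    rw [eq_convexHull_face hX hP hF.2.2, h, Finset.coe_pair]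
    exact finrank_direction_segment hab
  calc A.card = (A : Set (Finset ((Fin d → ℝ) × ℝ))).ncard := (Set.ncard_coe_finset A).symm
    _ ≤ _ := Set.ncard_le_ncard hsub (hfin.image _)
    _ ≤ S.ncard := Set.ncard_image_le hfin

theorem lower_bound_theorem (hd : 3 ≤ d) (hpoly : IsPolytope P) (hfull : affineSpan ℝ P = ⊤)
    (hsimp : IsSimplicial P) : d * faceCount P 0 ≤ faceCount P 1 + (d + 1).choose 2 := by
  obtain ⟨X, hX, hP⟩ := hpoly.exists_finset
  have hV : finrank ℝ ((Fin d → ℝ) × ℝ) = d + 1 := by simp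
  obtain ⟨A, B, hAB, hA, hB⟩ := (isSimplicialCone_liftFinset hX hP hfull hsimp).lower_bound hV hd
  calc d * faceCount P 0 ≤ d * A.card := Nat.mul_le_mul_left d (faceCount_zero_le hX hP hA)
    _ ≤ B.card + (d + 1).choose 2 := hAB
    _ ≤ faceCount P 1 + (d + 1).choose 2 :=
      Nat.add_le_add_right (le_faceCount_one hX hP hfull hB) _

end FaceCount

end LowerBound

theorem hP_one {d : ℕ} (P : Set (Fin d → ℝ)) : hP P 1 = faceCount P 0 - d := by
  simp [hP, fm, Finset.sum_range_succ]
  ring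

theorem hP_two {d : ℕ} (hd : 1 ≤ d) (P : Set (Fin d → ℝ)) :
    hP P 2 = faceCount P 1 - (d - 1) * faceCount P 0 + d.choose 2 := by
  simp [hP, fm, Finset.sum_range_succ, Nat.cast_sub hd]
  ring

/-- The Lower Bound Theorem: `h₁ ≤ h₂`, equivalently `f₁ ≥ d·f₀ - C(d+1,2)`. -/
theorem stmt15 {d : ℕ} (hd : 4 ≤ d) (P : Set (Fin d → ℝ))
    (hpoly : IsPolytope P) (hfull : affineSpan ℝ P = ⊤) (hsimp : IsSimplicial P) :
    hP P 1 ≤ hP P 2 ∧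
      (d : ℤ) * (faceCount P 0) - ((d + 1).choose 2 : ℤ) ≤ (faceCount P 1 : ℤ) := by
  have h := lower_bound_theorem (by omega) hpoly hfull hsimp
  have hchoose : (d + 1).choose 2 = d + d.choose 2 := by
    rw [Nat.choose_succ_succ' d 1, Nat.choose_one_right]
  zify at h hchoose
  rw [hchoose] at h ⊢
  rw [hP_one, hP_two (by omega)]
  constructor <;> linarith
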